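/- Let (v,p) be a smooth axisymmetric solution with no swirl of the steady Navier–Stokes equations on the periodic slab domain ℝ² × S¹ (i.e., (v·∇)v + ∇p = Δv, ∇·v = 0 in all of ℝ³, with v 2π-periodic in x₃), satisfying ∫_{ℝ²×S¹} |∇v(x)|^q dx < ∞ for some q ∈ [2,∞). Then the vorticity of v vanishes identically: ω^θ ≡ 0, so ∇ × v = 0 in ℝ³. -/

import Mathlib

open MeasureTheory Real Set Filter Topology

noncomputable section

/-- Three-dimensional Euclidean space. -/
abbrev E3 := EuclideanSpace ℝ (Fin 3)

/-- The distance to the `x₃`-axis, `r = √(x₁² + x₂²)`. -/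
def rr (x : E3) : ℝ := Real.sqrt ((x 0) ^ 2 + (x 1) ^ 2)

/-- Partial derivative of `g : ℝ³ → ℝ` in the `i`-th coordinate direction. -/
def pd (i : Fin 3) (g : E3 → ℝ) (x : E3) : ℝ := fderiv ℝ g x (EuclideanSpace.single i 1)

/-- Partial derivative in the first (radial) variable of a function of `(r,z)`. -/
def dr (f : ℝ → ℝ → ℝ) (r z : ℝ) : ℝ := deriv (fun s => f s z) r

/-- Partial derivative in the second (vertical) variable of a function of `(r,z)`. -/
def dzz (f : ℝ → ℝ → ℝ) (r z : ℝ) : ℝ := deriv (fun t => f r t) z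

/-- The azimuthal vorticity `ω^θ = ∂_z v^r − ∂_r v^z` of an axisymmetric vector
field without swirl, as a function of `(r,z)`. -/
def omTheta (vr vz : ℝ → ℝ → ℝ) (r z : ℝ) : ℝ := dzz vr r z - dr vz r z

/-- The rescaled azimuthal vorticity `Ω = ω^θ / r`. -/
def Om (vr vz : ℝ → ℝ → ℝ) (r z : ℝ) : ℝ := omTheta vr vz r z / r

/-- The squared Frobenius norm `|∇v|² = ∑ᵢⱼ (∂ᵢ vⱼ)²` of the gradient of a
vector field `v : ℝ³ → ℝ³`. -/
def gradSq3 (v : E3 → E3) (x : E3) : ℝ := ∑ i, ∑ j, (pd i (fun y => v y j) x) ^ 2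


/-- `v, p, vr, vz` constitute a smooth axisymmetric solution, without swirl, of the
steady Navier–Stokes equations in the periodic (in `x₃`, with period `2π`) slab
domain `ℝ² × S¹`, i.e. in all of `ℝ³` with `2π`-periodicity in `x₃`; the functions
`vr, vz` of `(r,z)` are the cylindrical components of `v`. -/
structure AxisymNoSwirlNSWholeSlab (v : E3 → E3) (p : E3 → ℝ)
    (vr vz : ℝ → ℝ → ℝ) : Prop where
  smooth_v : ContDiff ℝ (⊤ : ℕ∞) v
  smooth_p : ContDiff ℝ (⊤ : ℕ∞) p
  periodic : ∀ x : E3, v (x + (2 * π) • EuclideanSpace.single (2 : Fin 3) (1 : ℝ)) = v x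
  axisym_no_swirl : ∀ x : E3,
    v x 0 = vr (rr x) (x 2) * (x 0 / rr x) ∧
    v x 1 = vr (rr x) (x 2) * (x 1 / rr x) ∧
    v x 2 = vz (rr x) (x 2)
  momentum : ∀ x : E3, ∀ j : Fin 3,
    (∑ i, v x i * pd i (fun y => v y j) x) + pd j p x
      = ∑ i, pd i (pd i (fun y => v y j)) x
  incompressible : ∀ x : E3, (∑ i, pd i (fun y => v y i) x) = 0

/-- A monotone `Φ` on `(0,∞)` that is the leading part of the derivative of a function
which stays nonnegative and is small at both ends in an averaged sense must vanish. -/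
theorem monotone_flux_eq_zero {Φ Q K k m : ℝ → ℝ}
    (hΦ : MonotoneOn Φ (Ioi 0))
    (hQ : ∀ r, 0 < r → HasDerivAt Q (r * Φ r + K r) r)
    (hQ0 : ∀ r, 0 < r → 0 ≤ Q r)
    (hk : Continuous k) (hk0 : k 0 = 0) (hK : ∀ r, 0 < r → |K r| ≤ r * k r)
    (hm : Continuous m) (hQm : ∀ r, 0 < r → Q r ≤ r * m r)
    (hkint : ∀ ε, 0 < ε → ∃ C, ∀ R, 0 < R → ∫ r in (0:ℝ)..R, r * k r ≤ ε * R ^ 2 + C)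
    (hmint : ∃ C, ∀ R, 0 < R → ∫ r in (0:ℝ)..R, r * m r ≤ C * (R ^ 2 + 1)) :
    ∀ r, 0 < r → Φ r = 0 := by
  have hkd : ∀ r, HasDerivAt (fun R => ∫ r in (0:ℝ)..R, r * k r) (r * k r) r := fun r =>
    (by fun_prop : Continuous fun r => r * k r).integral_hasStrictDerivAt 0 r |>.hasDerivAt
  have hmd : ∀ r, HasDerivAt (fun R => ∫ r in (0:ℝ)..R, r * m r) (r * m r) r := fun r =>
    (by fun_prop : Continuous fun r => r * m r).integral_hasStrictDerivAt 0 r |>.hasDerivAt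
  intro a ha
  apply le_antisymm
  · by_contra! hc
    set c := Φ a with hcdef
    obtain ⟨C, hC⟩ := hkint (c / 4) (by positivity)
    obtain ⟨C2, hC2⟩ := hmint
    set N := fun R => ∫ r in (0:ℝ)..R, r * k r with hN
    set M := fun R => ∫ r in (0:ℝ)..R, r * m r with hM
    have h1 : MonotoneOn (fun r => Q r + N r - c * r ^ 2 / 2) (Ici a) := by
      have hd : ∀ r, 0 < r → HasDerivAt (fun r => Q r + N r - c * r ^ 2 / 2)
          (r * Φ r + K r + r * k r - c * r) r := fun r hr => by
        convert! ((hQ r hr).add (hkd r)).sub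
          ((((hasDerivAt_id r).pow 2).const_mul c).div_const 2) using 1
        simp; ring
      apply monotoneOn_of_deriv_nonneg (convex_Ici a)
      · intro r hr; exact (hd r (ha.trans_le hr)).continuousAt.continuousWithinAt
      · intro r hr; rw [interior_Ici] at hr
        exact (hd r (ha.trans hr)).differentiableAt.differentiableWithinAt
      · intro r hr; rw [interior_Ici] at hr
        have hr0 : 0 < r := ha.trans hr
        rw [(hd r hr0).deriv]
        have := (abs_le.1 (hK r hr0)).1
        have h2 := hΦ ha hr0 (le_of_lt hr)
        nlinarith
    have h2 : ∃ C', ∀ r, a ≤ r → c * r ^ 2 / 4 - C' ≤ Q r := by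
      refine ⟨C - (Q a + N a - c * a ^ 2 / 2), fun r hr => ?_⟩
      have := h1 (mem_Ici.2 le_rfl) hr hr
      have h3 := hC r (ha.trans_le hr)
      simp only at this
      change N r ≤ _ at h3
      linarith
    obtain ⟨C', hC'⟩ := h2
    have h3 : MonotoneOn (fun r => M r - c * r ^ 3 / 12 + C' * r) (Ici a) := by
      have hd : ∀ r, HasDerivAt (fun r => M r - c * r ^ 3 / 12 + C' * r)
          (r * m r - c * r ^ 2 / 4 + C') r := fun r => by
        convert! ((hmd r).sub
          ((((hasDerivAt_id r).pow 3).const_mul c).div_const 12)).add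
            ((hasDerivAt_id r).const_mul C') using 1
        simp; ring
      apply monotoneOn_of_deriv_nonneg (convex_Ici a)
      · intro r hr; exact (hd r).continuousAt.continuousWithinAt
      · intro r hr; exact (hd r).differentiableAt.differentiableWithinAt
      · intro r hr; rw [interior_Ici] at hr
        rw [(hd r).deriv]
        linarith [hC' r (le_of_lt hr), hQm r (ha.trans hr)]
    set B := M a - c * a ^ 3 / 12 + C' * a with hB
    have h4 : ∀ r, a ≤ r → c * r ^ 3 / 12 ≤ C2 * (r ^ 2 + 1) + C' * r - B := by
      intro r hr
      have := h3 (mem_Ici.2 le_rfl) hr hr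
      have h5 := hC2 r (ha.trans_le hr)
      change M r ≤ _ at h5
      simp only at this
      linarith
    set A := 2 * |C2| + |C'| + |B| with hA
    have h5 := h4 (max (max a 1) (12 * (A + 1) / c)) ((le_max_left _ _).trans (le_max_left _ _))
    set r := max (max a 1) (12 * (A + 1) / c) with hr
    have hr1 : 1 ≤ r := (le_max_right _ _).trans (le_max_left _ _)
    have hr2 : 12 * (A + 1) / c ≤ r := le_max_right _ _
    rw [div_le_iff₀ hc] at hr2
    have h6 : C2 * (r ^ 2 + 1) ≤ 2 * |C2| * r ^ 2 := by
      nlinarith [le_abs_self C2, abs_nonneg C2,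
        mul_nonneg (abs_nonneg C2) (by nlinarith : 0 ≤ r ^ 2 - 1),
        mul_nonneg (sub_nonneg.2 (le_abs_self C2)) (by positivity : 0 ≤ r ^ 2 + 1)]
    have h7 : C' * r ≤ |C'| * r ^ 2 := by
      have : C' * r ≤ |C'| * r := by gcongr; exact le_abs_self _
      have : |C'| * r ≤ |C'| * r ^ 2 := by gcongr; nlinarith
      linarith
    have h8 : -B ≤ |B| * r ^ 2 := by
      have := neg_abs_le B
      have : |B| * 1 ≤ |B| * r ^ 2 := by gcongr; nlinarith
      linarith
    have h9 : (A + 1) * r ^ 2 ≤ c * r ^ 3 / 12 := by nlinarith [sq_nonneg r]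
    have : A * r ^ 2 = 2 * |C2| * r ^ 2 + |C'| * r ^ 2 + |B| * r ^ 2 := by rw [hA]; ring
    nlinarith
  · by_contra! hc
    set c := -Φ a with hcdef
    have hc' : 0 < c := by linarith
    have hev : ∀ᶠ r in 𝓝 0, k r < c / 2 :=
      (hk.tendsto 0).eventually_lt_const (by rw [hk0]; positivity)
    obtain ⟨δ, hδ, hev⟩ := Metric.eventually_nhds_iff.1 hev
    set b := min a (δ / 2) with hb
    have hb0 : 0 < b := lt_min ha (by positivity)
    have hd : ∀ r, 0 < r → HasDerivAt (fun r => Q r + c * r ^ 2 / 4)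
        (r * Φ r + K r + c * r / 2) r := fun r hr => by
      convert! (hQ r hr).add ((((hasDerivAt_id r).pow 2).const_mul c).div_const 4) using 1
      simp; ring
    have h1 : AntitoneOn (fun r => Q r + c * r ^ 2 / 4) (Ioc 0 b) := by
      apply antitoneOn_of_deriv_nonpos (convex_Ioc 0 b)
      · intro r hr; exact (hd r hr.1).continuousAt.continuousWithinAt
      · intro r hr; rw [interior_Ioc] at hr
        exact (hd r hr.1).differentiableAt.differentiableWithinAt
      · intro r hr; rw [interior_Ioc] at hr
        rw [(hd r hr.1).deriv]
        have h2 := hΦ (show r ∈ Ioi (0:ℝ) from hr.1) ha (hr.2.le.trans (min_le_left _ _))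
        have h3 : k r < c / 2 := hev (by
          rw [dist_zero_right, norm_eq_abs, abs_of_pos hr.1]
          have := min_le_right a (δ / 2)
          linarith [hr.2])
        have h4 := (abs_le.1 (hK r hr.1)).2
        have h0 := hr.1
        nlinarith
    have h2 : Tendsto (fun r => r * m r + c * r ^ 2 / 4) (𝓝[>] 0) (𝓝 0) := by
      have : Continuous fun r => r * m r + c * r ^ 2 / 4 := by fun_prop
      have := this.tendsto 0
      simp only [zero_mul, ne_eq, OfNat.ofNat_ne_zero, not_false_eq_true, zero_pow, mul_zero, zero_div,
        add_zero] at this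
      exact this.mono_left nhdsWithin_le_nhds
    have h3 : Q b + c * b ^ 2 / 4 ≤ 0 := by
      apply ge_of_tendsto h2
      filter_upwards [Ioc_mem_nhdsGT hb0] with r hr
      have := h1 hr ⟨hb0, le_rfl⟩ hr.2
      simp only at this
      linarith [hQm r hr.1]
    have := hQ0 b hb0
    have : 0 < c * b ^ 2 := by positivity
    linarith

/-- A smooth strictly convex function with linear growth, vanishing only at the origin. -/
theorem exists_convex_linear_growth : ∃ F F₁ F₂ : ℝ → ℝ,
    (∀ s, HasDerivAt F (F₁ s) s) ∧ (∀ s, HasDerivAt F₁ (F₂ s) s) ∧ Continuous F₂ ∧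
    (∀ s, 0 < F₂ s) ∧ (∀ s, 0 ≤ F s) ∧ (∀ s, F s ≤ |s|) ∧ (∀ s, F s = 0 → s = 0) := by
  have hpos : ∀ s : ℝ, 0 < 1 + s ^ 2 := fun s => by positivity
  have hd : ∀ s : ℝ, HasDerivAt (fun s => √(1 + s ^ 2)) (s / √(1 + s ^ 2)) s := fun s => by
    convert! (((hasDerivAt_id s).pow 2).const_add 1).sqrt (hpos s).ne' using 1
    simp; field_simp
  refine ⟨fun s => √(1 + s ^ 2) - 1, fun s => s / √(1 + s ^ 2), fun s => 1 / √(1 + s ^ 2) ^ 3,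
    fun s => (hd s).sub_const 1, fun s => ?_, ?_, fun s => ?_, fun s => ?_, fun s => ?_,
    fun s hs => ?_⟩
  · have h0 : 0 < √(1 + s ^ 2) := Real.sqrt_pos.2 (hpos s)
    convert! (hasDerivAt_id s).div (hd s) h0.ne' using 1
    have := Real.sq_sqrt (hpos s).le
    simp only [id]
    field_simp
    linarith
  · refine continuous_const.div (by fun_prop) fun s => ?_
    have h0 : 0 < √(1 + s ^ 2) := Real.sqrt_pos.2 (hpos s)
    positivity
  · have h0 : 0 < √(1 + s ^ 2) := Real.sqrt_pos.2 (hpos s)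
    positivity
  · have : 1 ≤ √(1 + s ^ 2) := Real.one_le_sqrt.2 (by nlinarith)
    simpa using this
  · have : √(1 + s ^ 2) ≤ 1 + |s| := by
      rw [Real.sqrt_le_iff]
      refine ⟨by positivity, ?_⟩
      nlinarith [sq_abs s, abs_nonneg s]
    simp only; linarith
  · have h1 : √(1 + s ^ 2) = 1 := by simpa [sub_eq_zero] using hs
    have := Real.sq_sqrt (hpos s).le
    rw [h1] at this
    nlinarith

/-- Differentiation of `r ↦ ∫ g(r,z) dz` on `r > 0` under the integral sign. -/
theorem hasDerivAt_integral_strip {g g' : ℝ × ℝ → ℝ} {a b : ℝ}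
    (hg : ContinuousOn g (Ioi 0 ×ˢ univ)) (hg' : ContinuousOn g' (Ioi 0 ×ˢ univ))
    (hd : ∀ r z, 0 < r → HasDerivAt (fun s => g (s, z)) (g' (r, z)) r) {r : ℝ} (hr : 0 < r) :
    HasDerivAt (fun s => ∫ z in a..b, g (s, z)) (∫ z in a..b, g' (r, z)) r := by
  have hline : ∀ {f : ℝ × ℝ → ℝ}, ContinuousOn f (Ioi 0 ×ˢ univ) → ∀ s, 0 < s →
      Continuous fun z => f (s, z) := fun hf s hs =>
    hf.comp_continuous (by fun_prop) fun z => ⟨hs, mem_univ _⟩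
  have hcomp : IsCompact (Icc (r / 2) (2 * r) ×ˢ uIcc a b) := isCompact_Icc.prod isCompact_uIcc
  obtain ⟨C, hC⟩ := hcomp.exists_bound_of_continuousOn
    (hg'.mono (prod_mono (fun s hs => lt_of_lt_of_le (by positivity) hs.1) (subset_univ _)))
  refine (intervalIntegral.hasDerivAt_integral_of_dominated_loc_of_deriv_le
    (F := fun s z => g (s, z)) (F' := fun s z => g' (s, z)) (bound := fun _ => C)
    (s := Icc (r / 2) (2 * r)) (Icc_mem_nhds (by linarith) (by linarith)) ?_ ?_ ?_ ?_ ?_ ?_).2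
  · filter_upwards [Ioi_mem_nhds hr] with s hs
    exact (hline hg s hs).aestronglyMeasurable
  · exact (hline hg r hr).intervalIntegrable _ _
  · exact (hline hg' r hr).aestronglyMeasurable
  · exact ae_of_all _ fun z hz s hs => hC (s, z) ⟨hs, uIoc_subset_uIcc hz⟩
  · simp
  · exact ae_of_all _ fun z _ s hs => hd s z (lt_of_lt_of_le (by positivity) hs.1)

/-- Liouville theorem for the equation satisfied by the rescaled vorticity. -/
theorem rescaled_vorticity_eq_zero {W U Wr Uz θ θr θz θrr θzz : ℝ × ℝ → ℝ} {k m : ℝ → ℝ}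
    (hW : Continuous W) (hU : Continuous U) (hWrc : Continuous Wr)
    (hWr : ∀ r z, HasDerivAt (fun s => W (s, z)) (Wr (r, z)) r)
    (hUz : ∀ r z, HasDerivAt (fun t => U (r, t)) (Uz (r, z)) z) (hUzc : Continuous Uz)
    (hθc : ContinuousOn θ (Ioi 0 ×ˢ univ)) (hθrc : ContinuousOn θr (Ioi 0 ×ˢ univ))
    (hθzc : ContinuousOn θz (Ioi 0 ×ˢ univ))
    (hθzzc : ContinuousOn θzz (Ioi 0 ×ˢ univ))
    (hθr : ∀ r z, 0 < r → HasDerivAt (fun s => θ (s, z)) (θr (r, z)) r)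
    (hθz : ∀ r z, 0 < r → HasDerivAt (fun t => θ (r, t)) (θz (r, z)) z)
    (hθrr : ∀ r z, 0 < r → HasDerivAt (fun s => θr (s, z)) (θrr (r, z)) r)
    (hθzz : ∀ r z, 0 < r → HasDerivAt (fun t => θz (r, t)) (θzz (r, z)) z)
    (hUper : ∀ r, U (r, π) = U (r, -π)) (hθper : ∀ r, θ (r, π) = θ (r, -π))
    (hθzper : ∀ r, θz (r, π) = θz (r, -π))
    (hdiv : ∀ r z, 0 < r → Wr (r, z) + W (r, z) / r + Uz (r, z) = 0)
    (heq : ∀ r z, 0 < r → W (r, z) * θr (r, z) + U (r, z) * θz (r, z) =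
      θrr (r, z) + 3 * θr (r, z) / r + θzz (r, z))
    (hmean : ∀ r, 0 < r → ∫ z in -π..π, W (r, z) = 0)
    (hk : Continuous k) (hk0 : k 0 = 0)
    (hkW : ∀ r, 0 < r → r * ∫ z in -π..π, |θ (r, z)| * |W (r, z)| ≤ k r)
    (hm : Continuous m) (hmθ : ∀ r, 0 < r → r * ∫ z in -π..π, |θ (r, z)| ≤ m r)
    (hkint : ∀ ε, 0 < ε → ∃ C, ∀ R, 0 < R → ∫ r in (0:ℝ)..R, r * k r ≤ ε * R ^ 2 + C)
    (hmint : ∃ C, ∀ R, 0 < R → ∫ r in (0:ℝ)..R, r * m r ≤ C * (R ^ 2 + 1)) :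
    ∀ r z, 0 < r → z ∈ Icc (-π) π → θ (r, z) = 0 := by
  obtain ⟨F, F₁, F₂, hF, hF₁, hF₂c, hF₂, hF0, hFle, hFz⟩ := exists_convex_linear_growth
  have hFc : Continuous F := continuous_iff_continuousAt.2 fun s => (hF s).continuousAt
  have hF₁c : Continuous F₁ := continuous_iff_continuousAt.2 fun s => (hF₁ s).continuousAt
  have hππ : -π ≤ π := by linarith [pi_pos]
  have hline : ∀ {f : ℝ × ℝ → ℝ}, ContinuousOn f (Ioi 0 ×ˢ univ) → ∀ s, 0 < s →
      Continuous fun z => f (s, z) := fun hf s hs =>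
    hf.comp_continuous (by fun_prop) fun z => ⟨hs, mem_univ _⟩
  have hFθc : ContinuousOn (fun x => F (θ x)) (Ioi 0 ×ˢ univ) := hFc.comp_continuousOn hθc
  have hF₁θc : ContinuousOn (fun x => F₁ (θ x)) (Ioi 0 ×ˢ univ) := hF₁c.comp_continuousOn hθc
  have hF₂θc : ContinuousOn (fun x => F₂ (θ x)) (Ioi 0 ×ˢ univ) := hF₂c.comp_continuousOn hθc
  have hWo : ContinuousOn W (Ioi 0 ×ˢ univ) := hW.continuousOn
  have hUo : ContinuousOn U (Ioi 0 ×ˢ univ) := hU.continuousOn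
  have hWro : ContinuousOn Wr (Ioi 0 ×ˢ univ) := hWrc.continuousOn
  have hUzo : ContinuousOn Uz (Ioi 0 ×ˢ univ) := hUzc.continuousOn
  have hfst : ContinuousOn (fun x : ℝ × ℝ => x.1) (Ioi 0 ×ˢ univ) := continuousOn_fst
  have hFr : ∀ r z, 0 < r →
      HasDerivAt (fun s => F (θ (s, z))) (F₁ (θ (r, z)) * θr (r, z)) r := fun r z hr =>
    (hF _).comp r (hθr r z hr)
  have hF₁r : ∀ r z, 0 < r →
      HasDerivAt (fun s => F₁ (θ (s, z))) (F₂ (θ (r, z)) * θr (r, z)) r := fun r z hr =>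
    (hF₁ _).comp r (hθr r z hr)
  have hFz' : ∀ r z, 0 < r →
      HasDerivAt (fun t => F (θ (r, t))) (F₁ (θ (r, z)) * θz (r, z)) z := fun r z hr =>
    (hF _).comp z (hθz r z hr)
  have hF₁z : ∀ r z, 0 < r →
      HasDerivAt (fun t => F₁ (θ (r, t))) (F₂ (θ (r, z)) * θz (r, z)) z := fun r z hr =>
    (hF₁ _).comp z (hθz r z hr)
  set φ : ℝ × ℝ → ℝ := fun x =>
    x.1 * (F₁ (θ x) * θr x) + 2 * F (θ x) - x.1 * (W x * F (θ x)) with hφ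
  set D : ℝ × ℝ → ℝ := fun x => x.1 * F₂ (θ x) * (θr x ^ 2 + θz x ^ 2) with hD
  set ψ : ℝ × ℝ → ℝ := fun x => x.1 * (U x * F (θ x)) - x.1 * (F₁ (θ x) * θz x) with hψ
  set ψz : ℝ × ℝ → ℝ := fun x => x.1 * (Uz x * F (θ x) + U x * (F₁ (θ x) * θz x)) -
    x.1 * (F₂ (θ x) * θz x * θz x + F₁ (θ x) * θzz x) with hψz
  have hφc : ContinuousOn φ (Ioi 0 ×ˢ univ) := by fun_prop
  have hDc : ContinuousOn D (Ioi 0 ×ˢ univ) := by fun_prop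
  have hψzc : ContinuousOn ψz (Ioi 0 ×ˢ univ) := by fun_prop
  have hφd : ∀ r z, 0 < r → HasDerivAt (fun s => φ (s, z)) (D (r, z) + ψz (r, z)) r := by
    intro r z hr
    refine ((((hasDerivAt_id r).mul ((hF₁r r z hr).mul (hθrr r z hr))).add
      ((hFr r z hr).const_mul 2)).sub
      ((hasDerivAt_id r).mul ((hWr r z).mul (hFr r z hr)))).congr_deriv ?_
    have h1 := heq r z hr
    have h2 := hdiv r z hr
    simp only [hD, hψz, id, Pi.mul_apply]
    have h1' : r * (W (r, z) * θr (r, z) + U (r, z) * θz (r, z)) =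
      r * θrr (r, z) + 3 * θr (r, z) + r * θzz (r, z) := by rw [h1]; field_simp
    have h2' : r * Wr (r, z) + W (r, z) + r * Uz (r, z) = 0 := by
      have : r * (Wr (r, z) + W (r, z) / r + Uz (r, z)) = 0 := by rw [h2, mul_zero]
      rw [← this]; field_simp
    linear_combination (-F₁ (θ (r, z))) * h1' - F (θ (r, z)) * h2'
  have hψd : ∀ r z, 0 < r → HasDerivAt (fun t => ψ (r, t)) (ψz (r, z)) z := by
    intro r z hr
    refine ((((hUz r z).mul (hFz' r z hr)).const_mul r).sub
      (((hF₁z r z hr).mul (hθzz r z hr)).const_mul r)).congr_deriv ?_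
    simp only [hψz]
  have hψint : ∀ r, 0 < r → ∫ z in -π..π, ψz (r, z) = 0 := by
    intro r hr
    rw [intervalIntegral.integral_eq_sub_of_hasDerivAt (f := fun t => ψ (r, t))
      (fun z _ => hψd r z hr) ((hline hψzc r hr).intervalIntegrable _ _)]
    simp only [hψ, hUper, hθper, hθzper, sub_self]
  have hΦd : ∀ r, 0 < r →
      HasDerivAt (fun s => ∫ z in -π..π, φ (s, z)) (∫ z in -π..π, D (r, z)) r := by
    intro r hr
    refine (hasDerivAt_integral_strip (g' := fun x => D x + ψz x) hφc (by fun_prop) hφd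
      hr).congr_deriv ?_
    rw [intervalIntegral.integral_add ((hline hDc r hr).intervalIntegrable _ _)
      ((hline hψzc r hr).intervalIntegrable _ _), hψint r hr, add_zero]
  have hD0 : ∀ r z, 0 < r → 0 ≤ D (r, z) := fun r z hr => by
    have := hF₂ (θ (r, z))
    simp only [hD]; positivity
  have hΦ0 : ∀ r, 0 < r → ∫ z in -π..π, φ (r, z) = 0 := by
    refine monotone_flux_eq_zero (Q := fun r => r ^ 2 * ∫ z in -π..π, F (θ (r, z)))
      (K := fun r => r ^ 2 * ∫ z in -π..π, W (r, z) * F (θ (r, z))) ?_ ?_ ?_ hk hk0 ?_ hm ?_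
      hkint hmint
    · apply monotoneOn_of_deriv_nonneg (convex_Ioi 0)
      · intro r hr; exact (hΦd r hr).continuousAt.continuousWithinAt
      · intro r hr; rw [interior_Ioi] at hr
        exact (hΦd r hr).differentiableAt.differentiableWithinAt
      · intro r hr; rw [interior_Ioi] at hr
        rw [(hΦd r hr).deriv]
        exact intervalIntegral.integral_nonneg hππ fun z _ => hD0 r z hr
    · intro r hr
      refine (((hasDerivAt_id r).pow 2).mul (hasDerivAt_integral_strip
        (g' := fun x => F₁ (θ x) * θr x) hFθc (by fun_prop) hFr hr)).congr_deriv ?_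
      have i1 : Continuous fun z => F₁ (θ (r, z)) * θr (r, z) := hline
        (f := fun x => F₁ (θ x) * θr x) (by fun_prop) r hr
      have i2 : Continuous fun z => F (θ (r, z)) := hline hFθc r hr
      have i3 : Continuous fun z => W (r, z) * F (θ (r, z)) := by
        exact (hW.comp (by fun_prop : Continuous fun z : ℝ => (r, z))).mul i2
      have i12 : Continuous fun z => r * (F₁ (θ (r, z)) * θr (r, z)) + 2 * F (θ (r, z)) :=
        (i1.const_mul r).add (i2.const_mul 2)
      simp only [hφ]
      rw [intervalIntegral.integral_sub
          (i12.intervalIntegrable _ _)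
          ((i3.const_mul r).intervalIntegrable _ _),
        intervalIntegral.integral_add ((i1.const_mul r).intervalIntegrable _ _)
          ((i2.const_mul 2).intervalIntegrable _ _)]
      simp only [intervalIntegral.integral_const_mul]
      simp
      ring
    · intro r hr
      exact mul_nonneg (by positivity) (intervalIntegral.integral_nonneg hππ fun z _ => hF0 _)
    · intro r hr
      have i2 : Continuous fun z => F (θ (r, z)) := hline hFθc r hr
      have i3 : Continuous fun z => θ (r, z) := hline hθc r hr
      have i4 : Continuous fun z => W (r, z) := hline hWo r hr
      have h1 : |∫ z in -π..π, W (r, z) * F (θ (r, z))| ≤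
          ∫ z in -π..π, |θ (r, z)| * |W (r, z)| := by
        refine (intervalIntegral.abs_integral_le_integral_abs hππ).trans
          (intervalIntegral.integral_mono_on hππ
            ((i4.mul i2).abs.intervalIntegrable _ _)
            ((i3.abs.mul i4.abs).intervalIntegrable _ _) fun z _ => ?_)
        rw [abs_mul, abs_of_nonneg (hF0 _), mul_comm]
        gcongr
        exact hFle _
      have h2 := hkW r hr
      rw [abs_mul, abs_of_nonneg (by positivity : 0 ≤ r ^ 2)]
      calc _ ≤ r ^ 2 * ∫ z in -π..π, |θ (r, z)| * |W (r, z)| := by gcongr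
        _ = r * (r * ∫ z in -π..π, |θ (r, z)| * |W (r, z)|) := by ring
        _ ≤ _ := by gcongr
    · intro r hr
      have i2 : Continuous fun z => F (θ (r, z)) := hline hFθc r hr
      have i3 : Continuous fun z => θ (r, z) := hline hθc r hr
      calc r ^ 2 * ∫ z in -π..π, F (θ (r, z)) ≤ r ^ 2 * ∫ z in -π..π, |θ (r, z)| := by
            gcongr
            exact intervalIntegral.integral_mono_on hππ (i2.intervalIntegrable _ _)
              (i3.abs.intervalIntegrable _ _) fun z _ => hFle _
        _ = r * (r * ∫ z in -π..π, |θ (r, z)|) := by ring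
        _ ≤ _ := by gcongr; exact hmθ r hr
  intro r z hr hz
  have hDint : ∫ z in -π..π, D (r, z) = 0 := by
    refine (hΦd r hr).unique ((hasDerivAt_const r (0:ℝ)).congr_of_eventuallyEq ?_)
    filter_upwards [Ioi_mem_nhds hr] with s hs using hΦ0 s hs
  have hDz : ∀ z ∈ Icc (-π) π, D (r, z) = 0 := by
    by_contra! h
    obtain ⟨z, hz, hne⟩ := h
    have := intervalIntegral.integral_pos (f := fun z => D (r, z)) (a := -π) (b := π)
      (by linarith [pi_pos])
      (hline hDc r hr).continuousOn (fun z _ => hD0 r z hr)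
      ⟨z, hz, lt_of_le_of_ne (hD0 r z hr) hne.symm⟩
    linarith
  have hgrad : ∀ z ∈ Icc (-π) π, θr (r, z) = 0 ∧ θz (r, z) = 0 := by
    intro z hz
    have h := hDz z hz
    have h1 : 0 < r * F₂ (θ (r, z)) := mul_pos hr (hF₂ _)
    have h2 : θr (r, z) ^ 2 + θz (r, z) ^ 2 = 0 := by
      simpa [hD, h1.ne', hr.ne', (hF₂ (θ (r, z))).ne'] using h
    constructor <;> nlinarith [sq_nonneg (θr (r, z)), sq_nonneg (θz (r, z))]
  have hconst : ∀ z ∈ Icc (-π) π, θ (r, z) = θ (r, -π) :=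
    constant_of_has_deriv_right_zero (hline hθc r hr).continuousOn fun z hz => by
      have := hθz r z hr
      rw [(hgrad z (Ico_subset_Icc_self hz)).2] at this
      exact this.hasDerivWithinAt
  have h0 := hΦ0 r hr
  have h1 : ∫ z in -π..π, φ (r, z) =
      ∫ z in -π..π, (2 * F (θ (r, -π)) - r * F (θ (r, -π)) * W (r, z)) := by
    apply intervalIntegral.integral_congr
    intro z hz
    rw [uIcc_of_le hππ] at hz
    simp only [hφ, hconst z hz, (hgrad z hz).1]
    ring
  rw [h1, intervalIntegral.integral_sub (by simp)
    ((by fun_prop : Continuous fun z => r * F (θ (r, -π)) * W (r, z)).intervalIntegrable _ _),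
    intervalIntegral.integral_const_mul, intervalIntegral.integral_const_mul, hmean r hr] at h0
  simp only [intervalIntegral.integral_const, smul_eq_mul, mul_zero, sub_zero] at h0
  rw [hconst z hz]
  apply hFz
  have : π + π ≠ 0 := by positivity
  simpa [this] using h0

/-- Partial derivative in the first variable of a function on the plane. -/
def dFst (f : ℝ × ℝ → ℝ) (x : ℝ × ℝ) : ℝ := fderiv ℝ f x (1, 0)

/-- Partial derivative in the second variable of a function on the plane. -/
def dSnd (f : ℝ × ℝ → ℝ) (x : ℝ × ℝ) : ℝ := fderiv ℝ f x (0, 1)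

section PlanarDerivatives

variable {f g : ℝ × ℝ → ℝ}

theorem contDiff_dFst (hf : ContDiff ℝ (⊤ : ℕ∞) f) : ContDiff ℝ (⊤ : ℕ∞) (dFst f) :=
  (hf.fderiv_right (m := (⊤ : ℕ∞)) (by simp)).clm_apply contDiff_const

theorem contDiff_dSnd (hf : ContDiff ℝ (⊤ : ℕ∞) f) : ContDiff ℝ (⊤ : ℕ∞) (dSnd f) :=
  (hf.fderiv_right (m := (⊤ : ℕ∞)) (by simp)).clm_apply contDiff_const

theorem hasDerivAt_fst_line (hf : ContDiff ℝ (⊤ : ℕ∞) f) (r z : ℝ) :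
    HasDerivAt (fun s => f (s, z)) (dFst f (r, z)) r :=
  (hf.differentiable (by simp) (r, z)).hasFDerivAt.comp_hasDerivAt r
    ((hasDerivAt_id r).prodMk (hasDerivAt_const r z))

theorem hasDerivAt_snd_line (hf : ContDiff ℝ (⊤ : ℕ∞) f) (r z : ℝ) :
    HasDerivAt (fun t => f (r, t)) (dSnd f (r, z)) z :=
  (hf.differentiable (by simp) (r, z)).hasFDerivAt.comp_hasDerivAt z
    ((hasDerivAt_const z r).prodMk (hasDerivAt_id z))

theorem dFst_dSnd_comm (hf : ContDiff ℝ (⊤ : ℕ∞) f) : dFst (dSnd f) = dSnd (dFst f) := by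
  funext x
  have h1 : DifferentiableAt ℝ (fderiv ℝ f) x :=
    (hf.fderiv_right (m := (⊤ : ℕ∞)) (by simp)).differentiable (by simp) x
  have hs : IsSymmSndFDerivAt ℝ f x :=
    hf.contDiffAt.isSymmSndFDerivAt (by
      rw [minSmoothness_of_isRCLikeNormedField]; exact WithTop.coe_le_coe.2 (le_top : (2 : ℕ∞) ≤ ⊤))
  have h : ∀ a b : ℝ × ℝ, fderiv ℝ (fun y => fderiv ℝ f y a) x b = fderiv ℝ (fderiv ℝ f) x b a :=
    fun a b => by
      rw [fderiv_clm_apply h1 (differentiableAt_const a)]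
      simp
  change fderiv ℝ (fun y => fderiv ℝ f y (0, 1)) x (1, 0) =
    fderiv ℝ (fun y => fderiv ℝ f y (1, 0)) x (0, 1)
  rw [h, h]
  exact hs _ _

theorem dFst_sub (hf : ContDiff ℝ (⊤ : ℕ∞) f) (hg : ContDiff ℝ (⊤ : ℕ∞) g) :
    dFst (fun x => f x - g x) = fun x => dFst f x - dFst g x := by
  funext x
  simp only [dFst]
  rw [fderiv_fun_sub (hf.differentiable (by simp) x) (hg.differentiable (by simp) x)]
  rfl

theorem dSnd_sub (hf : ContDiff ℝ (⊤ : ℕ∞) f) (hg : ContDiff ℝ (⊤ : ℕ∞) g) :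
    dSnd (fun x => f x - g x) = fun x => dSnd f x - dSnd g x := by
  funext x
  simp only [dSnd]
  rw [fderiv_fun_sub (hf.differentiable (by simp) x) (hg.differentiable (by simp) x)]
  rfl

theorem fderiv_periodic_snd {c : ℝ} (hf : ∀ r z, f (r, z + c) = f (r, z)) (r z : ℝ) :
    fderiv ℝ f (r, z + c) = fderiv ℝ f (r, z) := by
  have h : (fun x => f (x + (0, c))) = f := by
    funext ⟨r, z⟩
    simpa using hf r z
  have := fderiv_comp_add_right (𝕜 := ℝ) (f := f) (x := (r, z)) (0, c)
  rw [h] at this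
  simpa using this.symm

theorem dFst_periodic_snd {c : ℝ} (hf : ∀ r z, f (r, z + c) = f (r, z)) (r z : ℝ) :
    dFst f (r, z + c) = dFst f (r, z) := by
  simp only [dFst, fderiv_periodic_snd hf]

theorem dSnd_periodic_snd {c : ℝ} (hf : ∀ r z, f (r, z + c) = f (r, z)) (r z : ℝ) :
    dSnd f (r, z + c) = dSnd f (r, z) := by
  simp only [dSnd, fderiv_periodic_snd hf]

end PlanarDerivatives

/-- The square of an integral is controlled by the integral of the square. -/
theorem sq_integral_le {g : ℝ → ℝ} {a b : ℝ} (hab : a < b) (hg : Continuous g) :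
    (∫ z in a..b, g z) ^ 2 ≤ (b - a) * ∫ z in a..b, g z ^ 2 := by
  set L := ∫ z in a..b, g z with hL
  have hb : 0 < b - a := sub_pos.2 hab
  have h : 0 ≤ ∫ z in a..b, (g z - L / (b - a)) ^ 2 :=
    intervalIntegral.integral_nonneg hab.le fun z _ => sq_nonneg _
  have h2 : ∫ z in a..b, (g z - L / (b - a)) ^ 2 =
      ∫ z in a..b, (g z ^ 2 - 2 * (L / (b - a)) * g z + (L / (b - a)) ^ 2) := by
    congr 1; funext z; ring
  rw [h2, intervalIntegral.integral_add
      ((by fun_prop : Continuous fun z => g z ^ 2 - 2 * (L / (b - a)) * g z).intervalIntegrable _ _)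
      (by simp), intervalIntegral.integral_sub
      ((by fun_prop : Continuous fun z => g z ^ 2).intervalIntegrable _ _)
      ((by fun_prop : Continuous fun z => 2 * (L / (b - a)) * g z).intervalIntegrable _ _),
    intervalIntegral.integral_const_mul, intervalIntegral.integral_const, ← hL] at h
  simp only [smul_eq_mul] at h
  have h3 : (b - a) * ((∫ z in a..b, g z ^ 2) - 2 * (L / (b - a)) * L +
      (b - a) * (L / (b - a)) ^ 2) = (b - a) * (∫ z in a..b, g z ^ 2) - L ^ 2 := by
    field_simp; ring
  have := mul_nonneg hb.le h
  rw [h3] at this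
  linarith

/-- Poincaré inequality on an interval for functions with zero mean. -/
theorem integral_sq_le_of_integral_eq_zero {g g' : ℝ → ℝ} {a b : ℝ} (hab : a < b)
    (hg : ∀ z, HasDerivAt g (g' z) z) (hg' : Continuous g') (h0 : ∫ z in a..b, g z = 0) :
    ∫ z in a..b, g z ^ 2 ≤ (b - a) ^ 2 * ∫ z in a..b, g' z ^ 2 := by
  have hb : 0 < b - a := sub_pos.2 hab
  have hgc : Continuous g := continuous_iff_continuousAt.2 fun s => (hg s).continuousAt
  set L := ∫ z in a..b, |g' z| with hL
  have hosc : ∀ z ∈ Icc a b, ∀ y ∈ Icc a b, |g z - g y| ≤ L := by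
    intro z hz y hy
    rw [← intervalIntegral.integral_eq_sub_of_hasDerivAt (f := g) (fun t _ => hg t)
      (hg'.intervalIntegrable _ _)]
    refine (intervalIntegral.norm_integral_le_abs_integral_norm (f := g') (μ := volume)).trans ?_
    rw [hL, ← abs_of_nonneg (intervalIntegral.integral_nonneg (μ := volume) hab.le
      fun z _ => abs_nonneg (g' z))]
    apply intervalIntegral.abs_integral_mono_interval
    · rw [uIoc_of_le hab.le]
      intro t ht
      rw [mem_uIoc] at ht
      constructor <;> rcases ht with ht | ht <;> linarith [hz.1, hz.2, hy.1, hy.2, ht.1, ht.2]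
    · exact ae_of_all _ fun t => abs_nonneg _
    · exact hg'.abs.intervalIntegrable _ _
  have hsup : ∀ z ∈ Icc a b, |g z| ≤ L := by
    intro z hz
    have h1 : ∫ y in a..b, (g z - g y) = (b - a) * g z := by
      rw [intervalIntegral.integral_sub (by simp) (hgc.intervalIntegrable _ _), h0]
      simp
    have h2 : ‖∫ y in a..b, (g z - g y)‖ ≤ L * |b - a| :=
      intervalIntegral.norm_integral_le_of_norm_le_const fun y hy => by
        rw [uIoc_of_le hab.le] at hy
        exact hosc z hz y (Ioc_subset_Icc_self hy)
    rw [h1, norm_mul, norm_eq_abs, norm_eq_abs, mul_comm, abs_of_pos hb] at h2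
    exact le_of_mul_le_mul_right h2 hb
  have hL2 : L ^ 2 ≤ (b - a) * ∫ z in a..b, g' z ^ 2 := by
    simpa only [sq_abs] using sq_integral_le hab hg'.abs
  calc ∫ z in a..b, g z ^ 2 ≤ ∫ z in a..b, L ^ 2 :=
        intervalIntegral.integral_mono_on hab.le ((hgc.pow 2).intervalIntegrable _ _) (by simp)
          fun z hz => by
            rw [← sq_abs]
            exact pow_le_pow_left₀ (abs_nonneg _) (hsup z hz) 2
    _ = (b - a) * L ^ 2 := by simp
    _ ≤ (b - a) * ((b - a) * ∫ z in a..b, g' z ^ 2) := by gcongr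
    _ = _ := by ring

/-- The curl of the planar form of the axisymmetric momentum equations. -/
theorem planar_vorticity_equation {W U P : ℝ × ℝ → ℝ}
    (hW : ContDiff ℝ (⊤ : ℕ∞) W) (hU : ContDiff ℝ (⊤ : ℕ∞) U) (hP : ContDiff ℝ (⊤ : ℕ∞) P)
    (hdiv : ∀ r z, 0 < r → dFst W (r, z) + W (r, z) / r + dSnd U (r, z) = 0)
    (hmr : ∀ r z, 0 < r → W (r, z) * dFst W (r, z) + U (r, z) * dSnd W (r, z) + dFst P (r, z) =
      dFst (dFst W) (r, z) + (dFst W (r, z) / r - W (r, z) / r ^ 2) + dSnd (dSnd W) (r, z))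
    (hmz : ∀ r z, 0 < r → W (r, z) * dFst U (r, z) + U (r, z) * dSnd U (r, z) + dSnd P (r, z) =
      dFst (dFst U) (r, z) + dFst U (r, z) / r + dSnd (dSnd U) (r, z))
    {ω : ℝ × ℝ → ℝ} (hω : ω = fun x => dSnd W x - dFst U x) (r z : ℝ) (hr : 0 < r) :
    W (r, z) * dFst ω (r, z) + U (r, z) * dSnd ω (r, z) - W (r, z) / r * ω (r, z) =
      dFst (dFst ω) (r, z) + dFst ω (r, z) / r + dSnd (dSnd ω) (r, z) - ω (r, z) / r ^ 2 := by
  have hWr := contDiff_dFst hW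
  have hWz := contDiff_dSnd hW
  have hUr := contDiff_dFst hU
  have hUz := contDiff_dSnd hU
  have e1 := (((hasDerivAt_snd_line hW r z).mul (hasDerivAt_snd_line hWr r z)).add
    ((hasDerivAt_snd_line hU r z).mul (hasDerivAt_snd_line hWz r z))).add
    (hasDerivAt_snd_line (contDiff_dFst hP) r z)
  have e2 := ((hasDerivAt_snd_line (contDiff_dFst hWr) r z).add
    (((hasDerivAt_snd_line hWr r z).div_const r).sub
      ((hasDerivAt_snd_line hW r z).div_const (r ^ 2)))).add
    (hasDerivAt_snd_line (contDiff_dSnd hWz) r z)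
  have h1 := e1.unique (e2.congr_of_eventuallyEq (Eventually.of_forall fun t => hmr r t hr))
  have e3 := (((hasDerivAt_fst_line hW r z).mul (hasDerivAt_fst_line hUr r z)).add
    ((hasDerivAt_fst_line hU r z).mul (hasDerivAt_fst_line hUz r z))).add
    (hasDerivAt_fst_line (contDiff_dSnd hP) r z)
  have e4 := ((hasDerivAt_fst_line (contDiff_dFst hUr) r z).add
    ((hasDerivAt_fst_line hUr r z).div (hasDerivAt_id r) hr.ne')).add
    (hasDerivAt_fst_line (contDiff_dSnd hUz) r z)
  have h2 := e3.unique (e4.congr_of_eventuallyEq (by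
    filter_upwards [Ioi_mem_nhds hr] with s hs using hmz s z hs))
  rw [dFst_dSnd_comm hP, dFst_dSnd_comm hU, dFst_dSnd_comm hUz, dFst_dSnd_comm hU] at h2
  have hd := hdiv r z hr
  rw [hω, dFst_sub hWz hUr, dSnd_sub hWz hUr, dFst_sub (contDiff_dFst hWz) (contDiff_dFst hUr),
    dSnd_sub (contDiff_dSnd hWz) (contDiff_dSnd hUr), dFst_dSnd_comm hW, dFst_dSnd_comm hWr]
  simp only [id] at h2
  have hr0 := hr.ne'
  field_simp at h1 h2 hd ⊢
  linear_combination h1 - h2 - (dSnd W (r, z) - dFst U (r, z)) * r * hd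

/-- By incompressibility, the radial velocity has zero mean in the periodic direction. -/
theorem integral_radial_velocity_eq_zero {W U : ℝ × ℝ → ℝ}
    (hW : ContDiff ℝ (⊤ : ℕ∞) W) (hU : ContDiff ℝ (⊤ : ℕ∞) U)
    (hUper : ∀ r, U (r, π) = U (r, -π))
    (hdiv : ∀ r z, 0 < r → dFst W (r, z) + W (r, z) / r + dSnd U (r, z) = 0)
    {r : ℝ} (hr : 0 < r) : ∫ z in -π..π, W (r, z) = 0 := by
  have hc : Continuous fun r => ∫ z in -π..π, W (r, z) :=
    intervalIntegral.continuous_parametric_intervalIntegral_of_continuous'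
      (f := fun r z => W (r, z)) hW.continuous _ _
  have hd : ∀ s, 0 < s → HasDerivAt (fun s => s * ∫ z in -π..π, W (s, z)) 0 s := by
    intro s hs
    refine ((hasDerivAt_id s).mul (hasDerivAt_integral_strip hW.continuous.continuousOn
      (contDiff_dFst hW).continuous.continuousOn
      (fun r z _ => hasDerivAt_fst_line hW r z) hs)).congr_deriv ?_
    have c1 : Continuous fun z => W (s, z) := hW.continuous.comp (by fun_prop)
    have c2 : Continuous fun z => dFst W (s, z) :=
      (contDiff_dFst hW).continuous.comp (by fun_prop)
    have c3 : Continuous fun z => dSnd U (s, z) :=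
      (contDiff_dSnd hU).continuous.comp (by fun_prop)
    have h0 : ∫ z in -π..π, dSnd U (s, z) = 0 := by
      rw [intervalIntegral.integral_eq_sub_of_hasDerivAt (f := fun t => U (s, t))
        (fun z _ => hasDerivAt_snd_line hU s z) (c3.intervalIntegrable _ _), hUper, sub_self]
    simp only [id, one_mul]
    rw [← intervalIntegral.integral_const_mul, ← intervalIntegral.integral_add
      (c1.intervalIntegrable _ _) ((c2.const_mul s).intervalIntegrable _ _)]
    have h1 : ∀ z, W (s, z) + s * dFst W (s, z) = -s * dSnd U (s, z) := fun z => by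
      have := hdiv s z hs
      field_simp at this
      linarith
    simp only [h1]
    rw [intervalIntegral.integral_const_mul, h0, mul_zero]
  have hcont : Continuous fun s => s * ∫ z in -π..π, W (s, z) := continuous_id.mul hc
  have hmono : MonotoneOn (fun s => s * ∫ z in -π..π, W (s, z)) (Icc 0 r) := by
    refine monotoneOn_of_deriv_nonneg (convex_Icc 0 r) hcont.continuousOn ?_ ?_
    · intro s hs; rw [interior_Icc] at hs
      exact (hd s hs.1).differentiableAt.differentiableWithinAt
    · intro s hs; rw [interior_Icc] at hs
      exact (hd s hs.1).deriv.ge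
  have hanti : AntitoneOn (fun s => s * ∫ z in -π..π, W (s, z)) (Icc 0 r) := by
    refine antitoneOn_of_deriv_nonpos (convex_Icc 0 r) hcont.continuousOn ?_ ?_
    · intro s hs; rw [interior_Icc] at hs
      exact (hd s hs.1).differentiableAt.differentiableWithinAt
    · intro s hs; rw [interior_Icc] at hs
      exact (hd s hs.1).deriv.le
  have h1 := hmono (left_mem_Icc.2 hr.le) (right_mem_Icc.2 hr.le) hr.le
  have h2 := hanti (left_mem_Icc.2 hr.le) (right_mem_Icc.2 hr.le) hr.le
  simp only [zero_mul] at h1 h2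
  have h3 := le_antisymm h2 h1
  simpa [hr.ne'] using h3

/-- Liouville theorem for the planar form of the axisymmetric Navier–Stokes equations, with the
finiteness of the Dirichlet integral replaced by an averaged growth bound. -/
theorem planar_curl_free {W U P : ℝ × ℝ → ℝ}
    (hW : ContDiff ℝ (⊤ : ℕ∞) W) (hU : ContDiff ℝ (⊤ : ℕ∞) U) (hP : ContDiff ℝ (⊤ : ℕ∞) P)
    (hWper : ∀ r z, W (r, z + 2 * π) = W (r, z)) (hUper : ∀ r z, U (r, z + 2 * π) = U (r, z))
    (hW0 : ∀ z, W (0, z) = 0)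
    (hdiv : ∀ r z, 0 < r → dFst W (r, z) + W (r, z) / r + dSnd U (r, z) = 0)
    (hmr : ∀ r z, 0 < r → W (r, z) * dFst W (r, z) + U (r, z) * dSnd W (r, z) + dFst P (r, z) =
      dFst (dFst W) (r, z) + (dFst W (r, z) / r - W (r, z) / r ^ 2) + dSnd (dSnd W) (r, z))
    (hmz : ∀ r z, 0 < r → W (r, z) * dFst U (r, z) + U (r, z) * dSnd U (r, z) + dSnd P (r, z) =
      dFst (dFst U) (r, z) + dFst U (r, z) / r + dSnd (dSnd U) (r, z))
    (hE : ∀ ε, 0 < ε → ∃ C, ∀ R, 0 < R → ∫ r in (0:ℝ)..R, r * (∫ z in -π..π,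
      ((dSnd W (r, z) - dFst U (r, z)) ^ 2 + dSnd W (r, z) ^ 2)) ≤ ε * R ^ 2 + C)
    (r z : ℝ) (hr : 0 < r) : dSnd W (r, z) = dFst U (r, z) := by
  set ω : ℝ × ℝ → ℝ := fun x => dSnd W x - dFst U x with hω
  have hωs : ContDiff ℝ (⊤ : ℕ∞) ω := (contDiff_dSnd hW).sub (contDiff_dFst hU)
  have hππ : -π < π := by linarith [pi_pos]
  have hends : ∀ {f : ℝ × ℝ → ℝ}, (∀ r z, f (r, z + 2 * π) = f (r, z)) →
      ∀ r, f (r, π) = f (r, -π) := fun hf r => by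
    rw [← hf r (-π)]; congr 2; ring
  have hωper : ∀ r z, ω (r, z + 2 * π) = ω (r, z) := fun r z => by
    simp only [hω, dSnd_periodic_snd hWper, dFst_periodic_snd hUper]
  have hvort := planar_vorticity_equation hW hU hP hdiv hmr hmz hω
  have hmean : ∀ r, 0 < r → ∫ z in -π..π, W (r, z) = 0 := fun r hr =>
    integral_radial_velocity_eq_zero hW hU (hends hUper) hdiv hr
  have hWzc := (contDiff_dSnd hW).continuous
  have hcpar : ∀ {f : ℝ × ℝ → ℝ}, Continuous f → Continuous fun r => ∫ z in -π..π, f (r, z) :=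
    fun {f} hf => intervalIntegral.continuous_parametric_intervalIntegral_of_continuous'
      (f := fun r z => f (r, z)) hf _ _
  have hWc := hW.continuous
  have hωc := hωs.continuous
  have hline : ∀ {f : ℝ × ℝ → ℝ}, Continuous f → ∀ r, Continuous fun z => f (r, z) :=
    fun hf r => hf.comp (by fun_prop)
  set E : ℝ → ℝ := fun r => ∫ z in -π..π, (ω (r, z) ^ 2 + dSnd W (r, z) ^ 2) with hEdef
  have hEc : Continuous E := hcpar (f := fun x => ω x ^ 2 + dSnd W x ^ 2) (by fun_prop)
  have hkc : Continuous fun r => ∫ z in -π..π, |ω (r, z)| * |W (r, z)| :=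
    hcpar (f := fun x => |ω x| * |W x|) (by fun_prop)
  have hmc : Continuous fun r => ∫ z in -π..π, |ω (r, z)| :=
    hcpar (f := fun x => |ω x|) (by fun_prop)
  have hω2 : ∀ r, Continuous fun z => ω (r, z) ^ 2 := fun r => (hline hωc r).pow 2
  have hW2 : ∀ r, Continuous fun z => W (r, z) ^ 2 := fun r => (hline hWc r).pow 2
  have hrE : Continuous fun r => r * E r := continuous_id.mul hEc
  have hEsplit : ∀ r, E r = (∫ z in -π..π, ω (r, z) ^ 2) + ∫ z in -π..π, dSnd W (r, z) ^ 2 :=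
    fun r => intervalIntegral.integral_add (((hline hωc r).pow 2).intervalIntegrable _ _)
      (((hline hWzc r).pow 2).intervalIntegrable _ _)
  have hnn1 : ∀ r, 0 ≤ ∫ z in -π..π, ω (r, z) ^ 2 := fun r =>
    intervalIntegral.integral_nonneg hππ.le fun z _ => sq_nonneg _
  have hnn2 : ∀ r, 0 ≤ ∫ z in -π..π, dSnd W (r, z) ^ 2 := fun r =>
    intervalIntegral.integral_nonneg hππ.le fun z _ => sq_nonneg _
  set B : ℝ := 1 + (π - -π) ^ 2 with hB
  have hB0 : 0 < B := by positivity
  have hkE : ∀ r, 0 < r → ∫ z in -π..π, |ω (r, z)| * |W (r, z)| ≤ B * E r := by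
    intro r hr
    have h1 := integral_sq_le_of_integral_eq_zero hππ (hasDerivAt_snd_line hW r)
      (hline hWzc r) (hmean r hr)
    have h2 : ∫ z in -π..π, |ω (r, z)| * |W (r, z)| ≤
        ∫ z in -π..π, (ω (r, z) ^ 2 + W (r, z) ^ 2) := by
      refine intervalIntegral.integral_mono_on hππ.le
        (((hline hωc r).abs.mul (hline hWc r).abs).intervalIntegrable _ _)
        ((((hline hωc r).pow 2).add ((hline hWc r).pow 2)).intervalIntegrable _ _) fun z _ => ?_
      nlinarith [sq_abs (ω (r, z)), sq_abs (W (r, z)), sq_nonneg (|ω (r, z)| - |W (r, z)|),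
        sq_nonneg (|ω (r, z)| + |W (r, z)|)]
    rw [intervalIntegral.integral_add ((hω2 r).intervalIntegrable _ _)
      ((hW2 r).intervalIntegrable _ _)] at h2
    rw [hEsplit r, hB]
    nlinarith [hnn1 r, hnn2 r, mul_nonneg (sq_nonneg (π - -π)) (hnn1 r)]
  have hmE : ∀ r, ∫ z in -π..π, |ω (r, z)| ≤ 2 * π + E r := by
    intro r
    have h2 : ∫ z in -π..π, |ω (r, z)| ≤ ∫ z in -π..π, (1 + ω (r, z) ^ 2) := by
      refine intervalIntegral.integral_mono_on hππ.le ((hline hωc r).abs.intervalIntegrable _ _)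
        ((continuous_const.add ((hline hωc r).pow 2)).intervalIntegrable _ _) fun z _ => ?_
      nlinarith [sq_abs (ω (r, z)), sq_nonneg (|ω (r, z)| - 1)]
    rw [intervalIntegral.integral_add (continuous_const.intervalIntegrable _ _)
      ((hω2 r).intervalIntegrable _ _)] at h2
    simp only [intervalIntegral.integral_const, smul_eq_mul, mul_one] at h2
    rw [hEsplit r]
    linarith [hnn2 r]
  have hdiv_lim : ∀ {f : ℝ × ℝ → ℝ}, Continuous f →
      ContinuousOn (fun x => f x / x.1) (Ioi 0 ×ˢ univ) := fun hf =>
    hf.continuousOn.div continuousOn_fst fun x hx => (ne_of_gt hx.1)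
  have hinv : ∀ n : ℕ, ContinuousOn (fun x : ℝ × ℝ => 1 / x.1 ^ n) (Ioi 0 ×ˢ univ) := fun n =>
    continuousOn_const.div (continuousOn_fst.pow n) fun x hx => pow_ne_zero _ (ne_of_gt hx.1)
  have hωrs := contDiff_dFst hωs
  have hωzs := contDiff_dSnd hωs
  have hmain : ∀ r z, 0 < r → z ∈ Icc (-π) π → ω (r, z) / r = 0 := by
    refine rescaled_vorticity_eq_zero (W := W) (U := U) (Wr := dFst W) (Uz := dSnd U)
      (θ := fun x => ω x / x.1)
      (θr := fun x => dFst ω x / x.1 - ω x * (1 / x.1 ^ 2))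
      (θz := fun x => dSnd ω x / x.1)
      (θrr := fun x => dFst (dFst ω) x / x.1 - 2 * (dFst ω x * (1 / x.1 ^ 2)) +
        2 * (ω x * (1 / x.1 ^ 3)))
      (θzz := fun x => dSnd (dSnd ω) x / x.1)
      (k := fun r => ∫ z in -π..π, |ω (r, z)| * |W (r, z)|)
      (m := fun r => ∫ z in -π..π, |ω (r, z)|)
      hWc hU.continuous (contDiff_dFst hW).continuous (hasDerivAt_fst_line hW)
      (hasDerivAt_snd_line hU) (contDiff_dSnd hU).continuous (hdiv_lim hωc)
      ((hdiv_lim hωrs.continuous).sub (hωc.continuousOn.mul (hinv 2)))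
      (hdiv_lim hωzs.continuous)
      (hdiv_lim (contDiff_dSnd hωzs).continuous)
      ?_ ?_ ?_ ?_ (hends hUper) ?_ ?_ hdiv ?_ hmean hkc ?_ ?_ hmc ?_ ?_ ?_
    · intro r z hr
      refine ((hasDerivAt_fst_line hωs r z).div (hasDerivAt_id r) hr.ne').congr_deriv ?_
      simp only [id]
      field_simp
    · intro r z hr
      exact (hasDerivAt_snd_line hωs r z).div_const r
    · intro r z hr
      have h2 : HasDerivAt (fun s : ℝ => 1 / s ^ 2) (-2 * (1 / r ^ 3)) r := by
        refine ((hasDerivAt_const r (1:ℝ)).div ((hasDerivAt_id r).pow 2)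
          (pow_ne_zero 2 hr.ne')).congr_deriv ?_
        simp
        field_simp
      refine (((hasDerivAt_fst_line hωrs r z).div (hasDerivAt_id r) hr.ne').sub
        ((hasDerivAt_fst_line hωs r z).mul h2)).congr_deriv ?_
      simp only [id]
      field_simp
      ring
    · intro r z hr
      exact (hasDerivAt_snd_line hωzs r z).div_const r
    · intro r
      simp only [hends hωper r]
    · intro r
      simp only [hends (dSnd_periodic_snd hωper) r]
    · intro r z hr
      have := hvort r z hr
      simp only
      field_simp at this ⊢
      linear_combination this
    · simp [hW0]
    · intro r hr
      rw [← intervalIntegral.integral_const_mul]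
      refine le_of_eq (intervalIntegral.integral_congr fun z _ => ?_)
      simp only [abs_div, abs_of_pos hr]
      field_simp
    · intro r hr
      rw [← intervalIntegral.integral_const_mul]
      refine le_of_eq (intervalIntegral.integral_congr fun z _ => ?_)
      simp only [abs_div, abs_of_pos hr]
      field_simp
    · intro ε hε
      obtain ⟨C, hC⟩ := hE (ε / B) (by positivity)
      refine ⟨B * C, fun R hR => ?_⟩
      calc _ ≤ ∫ r in (0:ℝ)..R, B * (r * E r) := by
            refine intervalIntegral.integral_mono_on_of_le_Ioo hR.le
              ((continuous_id.mul hkc).intervalIntegrable _ _)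
              ((continuous_const.mul (continuous_id.mul hEc)).intervalIntegrable _ _) fun r hr => ?_
            have := hkE r hr.1
            calc _ ≤ r * (B * E r) := mul_le_mul_of_nonneg_left this hr.1.le
              _ = _ := by ring
        _ = B * ∫ r in (0:ℝ)..R, r * E r := intervalIntegral.integral_const_mul _ _
        _ ≤ B * (ε / B * R ^ 2 + C) := by gcongr; exact hC R hR
        _ = _ := by field_simp
    · obtain ⟨C, hC⟩ := hE 1 one_pos
      refine ⟨π + 1 + |C|, fun R hR => ?_⟩
      calc _ ≤ ∫ r in (0:ℝ)..R, (2 * π * r + r * E r) := by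
            refine intervalIntegral.integral_mono_on_of_le_Ioo hR.le
              ((continuous_id.mul hmc).intervalIntegrable _ _)
              (((continuous_const.mul continuous_id).add
                (continuous_id.mul hEc)).intervalIntegrable _ _) fun r hr => ?_
            have := hmE r
            calc _ ≤ r * (2 * π + E r) := mul_le_mul_of_nonneg_left this hr.1.le
              _ = _ := by ring
        _ = π * R ^ 2 + ∫ r in (0:ℝ)..R, r * E r := by
            rw [intervalIntegral.integral_add
              ((by fun_prop : Continuous fun r : ℝ => 2 * π * r).intervalIntegrable _ _)
              (hrE.intervalIntegrable _ _),
              intervalIntegral.integral_const_mul, integral_id]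
            ring
        _ ≤ π * R ^ 2 + (1 * R ^ 2 + C) := by gcongr; exact hC R hR
        _ ≤ _ := by
            nlinarith [le_abs_self C, pi_pos, mul_nonneg (abs_nonneg C) (sq_nonneg R)]
  have hper : Function.Periodic (fun z => ω (r, z)) (2 * π) := fun z => hωper r z
  obtain ⟨y, hy, hzy⟩ := hper.exists_mem_Ico (by positivity) z (-π)
  have h0 := hmain r y hr ⟨hy.1, by linarith [hy.2]⟩
  have h1 : ω (r, z) = 0 := by
    rw [hzy]
    simpa [hr.ne'] using h0
  exact sub_eq_zero.1 h1

/-- The integral over `ℝ³` of a function of `(r,z)`, in cylindrical coordinates. -/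
theorem lintegral_cylindrical {G : ℝ × ℝ → ENNReal} (hG : Measurable G) :
    ∫⁻ x : E3, G (rr x, x 2) =
      (∫⁻ r in Ioi (0:ℝ), ∫⁻ z, ENNReal.ofReal r * G (r, z)) * ENNReal.ofReal (2 * π) := by
  have h2 : ∀ z, ∫⁻ y : Fin 2 → ℝ, G (√(y 0 ^ 2 + y 1 ^ 2), z) =
      (∫⁻ r in Ioi (0:ℝ), ENNReal.ofReal r * G (r, z)) * ENNReal.ofReal (2 * π) := by
    intro z
    have hm : Measurable fun r : ℝ => ENNReal.ofReal r * G (r, z) := by fun_prop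
    have e1 : ∫⁻ y : Fin 2 → ℝ, G (√(y 0 ^ 2 + y 1 ^ 2), z) =
        ∫⁻ p : ℝ × ℝ, G (√(p.1 ^ 2 + p.2 ^ 2), z) :=
      (volume_preserving_finTwoArrow ℝ).lintegral_comp_emb
        (MeasurableEquiv.finTwoArrow).measurableEmbedding
        (fun p : ℝ × ℝ => G (√(p.1 ^ 2 + p.2 ^ 2), z))
    rw [e1, ← lintegral_comp_polarCoord_symm]
    have e2 : ∫⁻ p in polarCoord.target, ENNReal.ofReal p.1 •
          G (√((polarCoord.symm p).1 ^ 2 + (polarCoord.symm p).2 ^ 2), z) =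
        ∫⁻ p in Ioi (0:ℝ) ×ˢ Ioo (-π) π, ENNReal.ofReal p.1 * G (p.1, z) := by
      rw [polarCoord_target]
      refine setLIntegral_congr_fun (measurableSet_Ioi.prod measurableSet_Ioo) fun p hp => ?_
      have hp1 : (0:ℝ) < p.1 := hp.1
      have : √((polarCoord.symm p).1 ^ 2 + (polarCoord.symm p).2 ^ 2) = p.1 := by
        rw [polarCoord_symm_apply]
        simp only
        rw [show (p.1 * cos p.2) ^ 2 + (p.1 * sin p.2) ^ 2 = p.1 ^ 2 by
          rw [mul_pow, mul_pow, ← mul_add, cos_sq_add_sin_sq, mul_one]]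
        exact Real.sqrt_sq hp1.le
      simp only [this, smul_eq_mul]
    rw [e2, Measure.volume_eq_prod, ← Measure.prod_restrict,
      lintegral_prod (fun p : ℝ × ℝ => ENNReal.ofReal p.1 * G (p.1, z))
        (hm.comp measurable_fst).aemeasurable]
    simp only [lintegral_const, MeasurableSet.univ, Measure.restrict_apply, univ_inter,
      Real.volume_Ioo]
    rw [lintegral_mul_const _ hm]
    congr 2; ring_nf
  have e3 : ∫⁻ x : E3, G (rr x, x 2) =
      ∫⁻ x : Fin 3 → ℝ, G (√(x 0 ^ 2 + x 1 ^ 2), x 2) :=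
    (PiLp.volume_preserving_ofLp (Fin 3)).lintegral_comp_emb
      (MeasurableEquiv.toLp 2 (Fin 3 → ℝ)).symm.measurableEmbedding
      (fun x : Fin 3 → ℝ => G (√(x 0 ^ 2 + x 1 ^ 2), x 2))
  have e4 : ∫⁻ x : Fin 3 → ℝ, G (√(x 0 ^ 2 + x 1 ^ 2), x 2) =
      ∫⁻ p : ℝ × (Fin 2 → ℝ), G (√(p.2 0 ^ 2 + p.2 1 ^ 2), p.1) :=
    (volume_preserving_piFinSuccAbove (fun _ : Fin 3 => ℝ) 2).lintegral_comp_emb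
      (MeasurableEquiv.piFinSuccAbove _ 2).measurableEmbedding
      (fun p : ℝ × (Fin 2 → ℝ) => G (√(p.2 0 ^ 2 + p.2 1 ^ 2), p.1))
  rw [e3, e4, Measure.volume_eq_prod, lintegral_prod _ (by fun_prop)]
  simp only [h2]
  rw [lintegral_mul_const _ (by fun_prop), lintegral_lintegral_swap (by fun_prop)]

/-- A function with finite integral over the slab against `|·|^(q/2)`, `q ≥ 2`, has averages over
large cylinders that are arbitrarily small. -/
theorem averaged_bound_of_lintegral_lt_top {e : ℝ × ℝ → ℝ} (he : Continuous e)
    (he0 : ∀ x, 0 ≤ e x) {q : ℝ} (hq : 2 ≤ q)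
    (hfin : ∫⁻ r in Ioi (0:ℝ), ∫⁻ z in Icc (-π) π,
      ENNReal.ofReal r * ENNReal.ofReal (e (r, z) ^ (q / 2)) < ⊤) :
    ∀ ε, 0 < ε → ∃ C, ∀ R, 0 < R →
      ∫ r in (0:ℝ)..R, r * (∫ z in -π..π, e (r, z)) ≤ ε * R ^ 2 + C := by
  intro ε hε
  have hππ : -π ≤ π := by linarith [pi_pos]
  set h : ℝ × ℝ → ℝ := fun x => e x ^ (q / 2) with hh
  have hc : Continuous h := he.rpow_const fun _ => Or.inr (by linarith)
  have hh0 : ∀ x, 0 ≤ h x := fun x => rpow_nonneg (he0 x) _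
  set η := ε / π with hη
  have hη0 : 0 < η := div_pos hε pi_pos
  set A := η ^ (1 - q / 2) with hA
  have hA0 : 0 < A := rpow_pos_of_pos hη0 _
  have hle : ∀ x, e x ≤ η + A * h x := by
    intro x
    rcases le_or_gt (e x) η with hx | hx
    · linarith [mul_nonneg hA0.le (hh0 x)]
    · have hpos : 0 < e x := hη0.trans hx
      have h1 : η ^ (q / 2 - 1) ≤ e x ^ (q / 2 - 1) :=
        rpow_le_rpow hη0.le hx.le (by linarith)
      have h2 : h x = e x ^ (q / 2 - 1) * e x := by
        rw [hh]; simp only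
        nth_rewrite 3 [← rpow_one (e x)]
        rw [← rpow_add hpos]; ring_nf
      have h3 : A * η ^ (q / 2 - 1) = 1 := by
        rw [hA, ← rpow_add hη0]; ring_nf; simp
      have : e x ≤ A * h x := by
        rw [h2, ← mul_assoc]
        have : 1 ≤ A * e x ^ (q / 2 - 1) :=
          h3.symm.le.trans (mul_le_mul_of_nonneg_left h1 hA0.le)
        nlinarith
      linarith
  set M := ∫⁻ r in Ioi (0:ℝ), ∫⁻ z in Icc (-π) π,
      ENNReal.ofReal r * ENNReal.ofReal (h (r, z)) with hM
  have hcpar : ∀ {f : ℝ × ℝ → ℝ}, Continuous f → Continuous fun r => ∫ z in -π..π, f (r, z) :=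
    fun {f} hf => intervalIntegral.continuous_parametric_intervalIntegral_of_continuous'
      (f := fun r z => f (r, z)) hf _ _
  have hrh : Continuous fun r => r * ∫ z in -π..π, h (r, z) := continuous_id.mul (hcpar hc)
  have hre : Continuous fun r => r * ∫ z in -π..π, e (r, z) := continuous_id.mul (hcpar he)
  have hMle : ∀ R, 0 < R → ∫ r in (0:ℝ)..R, r * (∫ z in -π..π, h (r, z)) ≤ M.toReal := by
    intro R hR
    have hnn : ∀ r ∈ Ioc 0 R, 0 ≤ r * (∫ z in -π..π, h (r, z)) := fun r hr =>
      mul_nonneg hr.1.le (intervalIntegral.integral_nonneg hππ fun z _ => hh0 _)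
    rw [← ENNReal.ofReal_le_iff_le_toReal hfin.ne, intervalIntegral.integral_of_le hR.le,
      ofReal_integral_eq_lintegral_ofReal
        (hrh.integrableOn_Icc.mono_set Ioc_subset_Icc_self)
        ((ae_restrict_iff' measurableSet_Ioc).2 (ae_of_all _ hnn))]
    calc _ = ∫⁻ r in Ioc 0 R, ∫⁻ z in Ioc (-π) π,
          ENNReal.ofReal r * ENNReal.ofReal (h (r, z)) := by
          refine setLIntegral_congr_fun measurableSet_Ioc fun r hr => ?_
          have hcr : Continuous fun z => h (r, z) := hc.comp (by fun_prop)
          rw [ENNReal.ofReal_mul hr.1.le, intervalIntegral.integral_of_le hππ,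
            ofReal_integral_eq_lintegral_ofReal
              (hcr.integrableOn_Icc.mono_set Ioc_subset_Icc_self) (ae_of_all _ fun z => hh0 _),
            lintegral_const_mul _ (by fun_prop)]
      _ ≤ ∫⁻ r in Ioi 0, ∫⁻ z in Ioc (-π) π,
          ENNReal.ofReal r * ENNReal.ofReal (h (r, z)) :=
          lintegral_mono_set Ioc_subset_Ioi_self
      _ ≤ M := lintegral_mono fun r => lintegral_mono_set Ioc_subset_Icc_self
  refine ⟨A * M.toReal, fun R hR => ?_⟩
  calc _ ≤ ∫ r in (0:ℝ)..R, (2 * ε * r + A * (r * ∫ z in -π..π, h (r, z))) := by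
        refine intervalIntegral.integral_mono_on hR.le (hre.intervalIntegrable _ _)
          ((by fun_prop : Continuous fun r => 2 * ε * r + A * (r * ∫ z in -π..π, h (r, z)))
            |>.intervalIntegrable _ _) fun r hr => ?_
        have hcr : Continuous fun z => h (r, z) := hc.comp (by fun_prop)
        have her : Continuous fun z => e (r, z) := he.comp (by fun_prop)
        have h1 : ∫ z in -π..π, e (r, z) ≤ ∫ z in -π..π, (η + A * h (r, z)) :=
          intervalIntegral.integral_mono_on hππ (her.intervalIntegrable _ _)
            ((by fun_prop : Continuous fun z => η + A * h (r, z)).intervalIntegrable _ _)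
            fun z _ => hle _
        rw [intervalIntegral.integral_add (by simp)
          ((by fun_prop : Continuous fun z => A * h (r, z)).intervalIntegrable _ _),
          intervalIntegral.integral_const_mul, intervalIntegral.integral_const] at h1
        have h2 : (π - -π) • η = 2 * ε := by
          rw [hη, smul_eq_mul]; field_simp; ring
        rw [h2] at h1
        calc _ ≤ r * (2 * ε + A * ∫ z in -π..π, h (r, z)) :=
              mul_le_mul_of_nonneg_left h1 hr.1
          _ = _ := by ring
    _ = ε * R ^ 2 + A * ∫ r in (0:ℝ)..R, r * (∫ z in -π..π, h (r, z)) := by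
        rw [intervalIntegral.integral_add
          ((by fun_prop : Continuous fun r : ℝ => 2 * ε * r).intervalIntegrable _ _)
          ((by fun_prop : Continuous fun r => A * (r * ∫ z in -π..π, h (r, z)))
            |>.intervalIntegrable _ _),
          intervalIntegral.integral_const_mul, intervalIntegral.integral_const_mul, integral_id]
        ring
    _ ≤ _ := by gcongr; exact hMle R hR

/-- The embedding of the `(r,z)`-plane as the half-plane `x₂ = 0` through the axis. -/
def meridian : ℝ × ℝ →L[ℝ] E3 :=
  (ContinuousLinearMap.fst ℝ ℝ ℝ).smulRight (EuclideanSpace.single 0 1) +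
    (ContinuousLinearMap.snd ℝ ℝ ℝ).smulRight (EuclideanSpace.single 2 1)

theorem meridian_apply_zero (x : ℝ × ℝ) : meridian x 0 = x.1 := by simp [meridian]

theorem meridian_apply_one (x : ℝ × ℝ) : meridian x 1 = 0 := by simp [meridian]

theorem meridian_apply_two (x : ℝ × ℝ) : meridian x 2 = x.2 := by simp [meridian]

theorem meridian_add_period (r z c : ℝ) :
    meridian (r, z + c) = meridian (r, z) + c • EuclideanSpace.single (2 : Fin 3) (1 : ℝ) := by
  simp [meridian, add_smul, add_assoc]

theorem rr_meridian {r : ℝ} (hr : 0 ≤ r) (z : ℝ) : rr (meridian (r, z)) = r := by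
  simp [rr, meridian_apply_zero, meridian_apply_one, Real.sqrt_sq hr]

theorem dFst_comp_meridian {g : E3 → ℝ} (hg : ContDiff ℝ (⊤ : ℕ∞) g) :
    dFst (fun x => g (meridian x)) = fun x => pd 0 g (meridian x) := by
  funext x
  have h := (hg.differentiable (by simp) (meridian x)).hasFDerivAt.comp x meridian.hasFDerivAt
  have h' : fderiv ℝ (fun x => g (meridian x)) x = _ := h.fderiv
  rw [dFst, h', pd]
  simp [meridian]

theorem dSnd_comp_meridian {g : E3 → ℝ} (hg : ContDiff ℝ (⊤ : ℕ∞) g) :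
    dSnd (fun x => g (meridian x)) = fun x => pd 2 g (meridian x) := by
  funext x
  have h := (hg.differentiable (by simp) (meridian x)).hasFDerivAt.comp x meridian.hasFDerivAt
  have h' : fderiv ℝ (fun x => g (meridian x)) x = _ := h.fderiv
  rw [dSnd, h', pd]
  simp [meridian]

theorem contDiff_pd {g : E3 → ℝ} (hg : ContDiff ℝ (⊤ : ℕ∞) g) (i : Fin 3) :
    ContDiff ℝ (⊤ : ℕ∞) (pd i g) :=
  (hg.fderiv_right (m := (⊤ : ℕ∞)) (by simp)).clm_apply contDiff_const

theorem contDiff_component {v : E3 → E3} (hv : ContDiff ℝ (⊤ : ℕ∞) v) (j : Fin 3) :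
    ContDiff ℝ (⊤ : ℕ∞) fun y => v y j :=
  (contDiff_euclidean.1 hv) j

theorem hasDerivAt_line {g : E3 → ℝ} (hg : ContDiff ℝ (⊤ : ℕ∞) g) (x e : E3) :
    HasDerivAt (fun t : ℝ => g (x + t • e)) (fderiv ℝ g x e) 0 := by
  have h : HasDerivAt (fun t : ℝ => x + t • e) e 0 := by
    simpa using ((hasDerivAt_id (0:ℝ)).smul_const e).const_add x
  have hx : HasFDerivAt g (fderiv ℝ g x) (x + (0:ℝ) • e) := by
    simpa using (hg.differentiable (by simp) x).hasFDerivAt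
  exact hx.comp_hasDerivAt 0 h

theorem pd_eq_of_hasDerivAt {g : E3 → ℝ} (hg : ContDiff ℝ (⊤ : ℕ∞) g) {x : E3} {i : Fin 3} {d : ℝ}
    (h : HasDerivAt (fun t : ℝ => g (x + t • EuclideanSpace.single i 1)) d 0) : pd i g x = d :=
  (hasDerivAt_line hg x _).unique h

theorem hasDerivAt_coord_line (x e : E3) (j : Fin 3) :
    HasDerivAt (fun t : ℝ => (x + t • e) j) (e j) 0 := by
  simpa using ((hasDerivAt_id (0:ℝ)).mul_const (e j)).const_add (x j)

theorem hasDerivAt_rr_line {x : E3} (hx : 0 < rr x) (e : E3) :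
    HasDerivAt (fun t : ℝ => rr (x + t • e)) ((x 0 * e 0 + x 1 * e 1) / rr x) 0 := by
  have h0 : (x 0) ^ 2 + (x 1) ^ 2 ≠ 0 := (Real.sqrt_pos.1 hx).ne'
  have h := (((hasDerivAt_coord_line x e 0).pow 2).add
    ((hasDerivAt_coord_line x e 1).pow 2)).sqrt (by simpa using h0)
  refine h.congr_deriv ?_
  simp only [rr, Pi.add_apply, Pi.pow_apply, zero_smul, add_zero]
  have : √(x 0 ^ 2 + x 1 ^ 2) ≠ 0 := hx.ne'
  field_simp
  ring

theorem hasDerivAt_planar_line {f : ℝ × ℝ → ℝ} (hf : ContDiff ℝ (⊤ : ℕ∞) f) {x : E3}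
    (hx : 0 < rr x) (e : E3) :
    HasDerivAt (fun t : ℝ => f (rr (x + t • e), (x + t • e) 2))
      (dFst f (rr x, x 2) * ((x 0 * e 0 + x 1 * e 1) / rr x) + dSnd f (rr x, x 2) * e 2) 0 := by
  have hF : HasFDerivAt f (fderiv ℝ f (rr x, x 2)) (rr (x + (0:ℝ) • e), (x + (0:ℝ) • e) 2) := by
    simpa using (hf.differentiable (by simp) (rr x, x 2)).hasFDerivAt
  refine (hF.comp_hasDerivAt 0
    ((hasDerivAt_rr_line hx e).prodMk (hasDerivAt_coord_line x e 2))).congr_deriv ?_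
  have : (((x 0 * e 0 + x 1 * e 1) / rr x, e 2) : ℝ × ℝ) =
      ((x 0 * e 0 + x 1 * e 1) / rr x) • ((1:ℝ), (0:ℝ)) + (e 2) • ((0:ℝ), (1:ℝ)) := by simp
  rw [this, map_add, map_smul, map_smul, dFst, dSnd, smul_eq_mul, smul_eq_mul]
  ring

theorem hasDerivAt_radial_line {f : ℝ × ℝ → ℝ} (hf : ContDiff ℝ (⊤ : ℕ∞) f) {x : E3}
    (hx : 0 < rr x) (e : E3) (a : Fin 3) :
    HasDerivAt (fun t : ℝ => f (rr (x + t • e), (x + t • e) 2) * ((x + t • e) a / rr (x + t • e)))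
      ((dFst f (rr x, x 2) * ((x 0 * e 0 + x 1 * e 1) / rr x) + dSnd f (rr x, x 2) * e 2) *
          (x a / rr x) +
        f (rr x, x 2) * (e a / rr x - x a * (x 0 * e 0 + x 1 * e 1) / rr x ^ 3)) 0 := by
  have h := (hasDerivAt_planar_line hf hx e).mul
    ((hasDerivAt_coord_line x e a).div (hasDerivAt_rr_line hx e) (by simpa using hx.ne'))
  refine h.congr_deriv ?_
  simp only [Pi.div_apply, zero_smul, add_zero]
  field_simp

/-- The field `v` is axisymmetric without swirl, with smooth radial and vertical profiles `W` and
`U`. -/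
structure HasProfiles (v : E3 → E3) (W U : ℝ × ℝ → ℝ) : Prop where
  contDiff_field : ContDiff ℝ (⊤ : ℕ∞) v
  contDiff_radial : ContDiff ℝ (⊤ : ℕ∞) W
  contDiff_vertical : ContDiff ℝ (⊤ : ℕ∞) U
  apply_zero : ∀ x, v x 0 = W (rr x, x 2) * (x 0 / rr x)
  apply_one : ∀ x, v x 1 = W (rr x, x 2) * (x 1 / rr x)
  apply_two : ∀ x, v x 2 = U (rr x, x 2)

namespace HasProfiles

variable {v : E3 → E3} {W U : ℝ × ℝ → ℝ}

theorem pd_zero (h : HasProfiles v W U) {x : E3} (hx : 0 < rr x) (i : Fin 3) :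
    pd i (fun y => v y 0) x =
      (dFst W (rr x, x 2) * ((x 0 * EuclideanSpace.single (𝕜 := ℝ) i 1 0 +
          x 1 * EuclideanSpace.single (𝕜 := ℝ) i 1 1) / rr x) +
        dSnd W (rr x, x 2) * EuclideanSpace.single (𝕜 := ℝ) i 1 2) * (x 0 / rr x) +
      W (rr x, x 2) * (EuclideanSpace.single (𝕜 := ℝ) i 1 0 / rr x -
        x 0 * (x 0 * EuclideanSpace.single (𝕜 := ℝ) i 1 0 +
          x 1 * EuclideanSpace.single (𝕜 := ℝ) i 1 1) / rr x ^ 3) := by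
  refine pd_eq_of_hasDerivAt (contDiff_component h.contDiff_field 0) ?_
  simp only [h.apply_zero]
  exact hasDerivAt_radial_line h.contDiff_radial hx _ 0

theorem pd_one (h : HasProfiles v W U) {x : E3} (hx : 0 < rr x) (i : Fin 3) :
    pd i (fun y => v y 1) x =
      (dFst W (rr x, x 2) * ((x 0 * EuclideanSpace.single (𝕜 := ℝ) i 1 0 +
          x 1 * EuclideanSpace.single (𝕜 := ℝ) i 1 1) / rr x) +
        dSnd W (rr x, x 2) * EuclideanSpace.single (𝕜 := ℝ) i 1 2) * (x 1 / rr x) +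
      W (rr x, x 2) * (EuclideanSpace.single (𝕜 := ℝ) i 1 1 / rr x -
        x 1 * (x 0 * EuclideanSpace.single (𝕜 := ℝ) i 1 0 +
          x 1 * EuclideanSpace.single (𝕜 := ℝ) i 1 1) / rr x ^ 3) := by
  refine pd_eq_of_hasDerivAt (contDiff_component h.contDiff_field 1) ?_
  simp only [h.apply_one]
  exact hasDerivAt_radial_line h.contDiff_radial hx _ 1

theorem pd_two (h : HasProfiles v W U) {x : E3} (hx : 0 < rr x) (i : Fin 3) :
    pd i (fun y => v y 2) x =
      dFst U (rr x, x 2) * ((x 0 * EuclideanSpace.single (𝕜 := ℝ) i 1 0 +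
          x 1 * EuclideanSpace.single (𝕜 := ℝ) i 1 1) / rr x) +
        dSnd U (rr x, x 2) * EuclideanSpace.single (𝕜 := ℝ) i 1 2 := by
  refine pd_eq_of_hasDerivAt (contDiff_component h.contDiff_field 2) ?_
  simp only [h.apply_two]
  exact hasDerivAt_planar_line h.contDiff_vertical hx _

end HasProfiles

theorem rr_sq (x : E3) : rr x ^ 2 = x 0 ^ 2 + x 1 ^ 2 :=
  Real.sq_sqrt (by positivity)

theorem continuous_rr : Continuous rr := by unfold rr; fun_prop

theorem hasDerivAt_mul_of_continuousAt {k : ℝ → ℝ} (hk : ContinuousAt k 0) :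
    HasDerivAt (fun t => t * k t) (k 0) 0 := by
  rw [hasDerivAt_iff_tendsto_slope]
  refine (hk.tendsto.mono_left nhdsWithin_le_nhds).congr' ?_
  filter_upwards [self_mem_nhdsWithin] with t ht
  have : t ≠ 0 := ht
  simp [slope_def_field, this]

namespace HasProfiles

variable {v : E3 → E3} {W U : ℝ × ℝ → ℝ}

theorem rr_meridian_line_pos {r : ℝ} (hr : 0 < r) (z t : ℝ) :
    0 < rr (meridian (r, z) + t • EuclideanSpace.single 1 1) := by
  refine Real.sqrt_pos.2 ?_
  simp [meridian_apply_zero, meridian_apply_one]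
  positivity

theorem pd_one_pd_one_zero (h : HasProfiles v W U) {r : ℝ} (hr : 0 < r) (z : ℝ) :
    pd 1 (pd 1 fun y => v y 0) (meridian (r, z)) = dFst W (r, z) / r - W (r, z) / r ^ 2 := by
  refine pd_eq_of_hasDerivAt (contDiff_pd (contDiff_component h.contDiff_field 0) 1) ?_
  set R : ℝ → ℝ := fun t => rr (meridian (r, z) + t • EuclideanSpace.single 1 1) with hR
  have hRpos : ∀ t, 0 < R t := rr_meridian_line_pos hr z
  have hRc : Continuous R := continuous_rr.comp (by fun_prop)
  have hR0 : R 0 = r := by simp [hR, rr_meridian hr.le]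
  have hW := h.contDiff_radial.continuous
  have hW' := (contDiff_dFst h.contDiff_radial).continuous
  have hk : Continuous fun t => dFst W (R t, z) * r / R t ^ 2 - W (R t, z) * r / R t ^ 3 :=
    ((by fun_prop : Continuous fun t => dFst W (R t, z) * r).div (hRc.pow 2)
      fun t => pow_ne_zero _ (hRpos t).ne').sub
    ((by fun_prop : Continuous fun t => W (R t, z) * r).div (hRc.pow 3)
      fun t => pow_ne_zero _ (hRpos t).ne')
  refine ((hasDerivAt_mul_of_continuousAt hk.continuousAt).congr_of_eventuallyEq
    (Eventually.of_forall fun t => ?_)).congr_deriv ?_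
  · have := (hRpos t).ne'
    rw [h.pd_zero (hRpos t) 1]
    simp only [hR] at this
    simp [hR, meridian_apply_zero, meridian_apply_one, meridian_apply_two]
    field_simp
    ring
  · simp only [hR0]
    field_simp

theorem pd_one_pd_one_two (h : HasProfiles v W U) {r : ℝ} (hr : 0 < r) (z : ℝ) :
    pd 1 (pd 1 fun y => v y 2) (meridian (r, z)) = dFst U (r, z) / r := by
  refine pd_eq_of_hasDerivAt (contDiff_pd (contDiff_component h.contDiff_field 2) 1) ?_
  set R : ℝ → ℝ := fun t => rr (meridian (r, z) + t • EuclideanSpace.single 1 1) with hR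
  have hRpos : ∀ t, 0 < R t := rr_meridian_line_pos hr z
  have hRc : Continuous R := continuous_rr.comp (by fun_prop)
  have hR0 : R 0 = r := by simp [hR, rr_meridian hr.le]
  have hU' := (contDiff_dFst h.contDiff_vertical).continuous
  have hk : Continuous fun t => dFst U (R t, z) / R t :=
    (by fun_prop : Continuous fun t => dFst U (R t, z)).div hRc fun t => (hRpos t).ne'
  refine ((hasDerivAt_mul_of_continuousAt hk.continuousAt).congr_of_eventuallyEq
    (Eventually.of_forall fun t => ?_)).congr_deriv ?_
  · rw [h.pd_two (hRpos t) 1]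
    simp [hR, meridian_apply_zero, meridian_apply_one, meridian_apply_two]
    ring
  · simp only [hR0]

/-- The vertical shears of the profiles are controlled by the full gradient. -/
theorem shear_le_gradSq3 (h : HasProfiles v W U) {x : E3} (hx : 0 < rr x) :
    (dSnd W (rr x, x 2) - dFst U (rr x, x 2)) ^ 2 + dSnd W (rr x, x 2) ^ 2 ≤
      3 * gradSq3 v x := by
  have hsq := rr_sq x
  have hw : pd 2 (fun y => v y 0) x ^ 2 + pd 2 (fun y => v y 1) x ^ 2 =
      dSnd W (rr x, x 2) ^ 2 := by
    rw [h.pd_zero hx, h.pd_one hx]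
    simp
    field_simp
    rw [hsq]
  have hu : pd 0 (fun y => v y 2) x ^ 2 + pd 1 (fun y => v y 2) x ^ 2 =
      dFst U (rr x, x 2) ^ 2 := by
    rw [h.pd_two hx, h.pd_two hx]
    simp
    field_simp
    rw [hsq]
  have hle : dSnd W (rr x, x 2) ^ 2 + dFst U (rr x, x 2) ^ 2 ≤ gradSq3 v x := by
    rw [← hw, ← hu, gradSq3]
    simp only [Fin.sum_univ_three]
    nlinarith [sq_nonneg (pd 0 (fun y => v y 0) x), sq_nonneg (pd 0 (fun y => v y 1) x),
      sq_nonneg (pd 1 (fun y => v y 0) x), sq_nonneg (pd 1 (fun y => v y 1) x),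
      sq_nonneg (pd 2 (fun y => v y 2) x)]
  nlinarith [sq_nonneg (dSnd W (rr x, x 2) + dFst U (rr x, x 2)),
    sq_nonneg (dFst U (rr x, x 2))]

theorem curl_free_of_planar (h : HasProfiles v W U)
    (hcurl : ∀ r z, 0 < r → dSnd W (r, z) = dFst U (r, z)) (x : E3) (i j : Fin 3) :
    pd i (fun y => v y j) x = pd j (fun y => v y i) x := by
  have key : ∀ x, 0 < rr x → pd i (fun y => v y j) x = pd j (fun y => v y i) x := by
    intro x hx
    have hc := hcurl (rr x) (x 2) hx
    fin_cases i <;> fin_cases j <;>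
      simp [h.pd_zero hx, h.pd_one hx, h.pd_two hx, hc] <;> ring
  rcases (Real.sqrt_nonneg (x 0 ^ 2 + x 1 ^ 2)).lt_or_eq with hx | hx
  · exact key x hx
  have h0 : x 0 = 0 := by
    have := rr_sq x
    rw [rr, ← hx] at this
    nlinarith [sq_nonneg (x 0), sq_nonneg (x 1)]
  have hline : Tendsto (fun t : ℝ => x + t • EuclideanSpace.single (0 : Fin 3) (1 : ℝ))
      (𝓝[≠] 0) (𝓝 x) := by
    have : Continuous fun t : ℝ => x + t • EuclideanSpace.single (0 : Fin 3) (1 : ℝ) := by fun_prop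
    simpa using (this.tendsto 0).mono_left nhdsWithin_le_nhds
  have hlim : ∀ i j, Tendsto (fun t : ℝ =>
      pd i (fun y => v y j) (x + t • EuclideanSpace.single (0 : Fin 3) (1 : ℝ))) (𝓝[≠] 0)
      (𝓝 (pd i (fun y => v y j) x)) := fun i j =>
    ((contDiff_pd (contDiff_component h.contDiff_field j) i).continuous.tendsto x).comp hline
  refine tendsto_nhds_unique ((hlim i j).congr' ?_) (hlim j i)
  filter_upwards [self_mem_nhdsWithin] with t ht
  have ht : t ≠ 0 := ht
  refine key _ (Real.sqrt_pos.2 ?_)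
  simp [h0]
  positivity

/-- A finite generalized Dirichlet integral over the slab controls the shear of the profiles. -/
theorem averaged_shear_bound (h : HasProfiles v W U) {q : ℝ} (hq : 2 ≤ q)
    (hfin : ∫⁻ x : E3 in {x : E3 | x 2 ∈ Icc (-π) π},
      ENNReal.ofReal ((gradSq3 v x) ^ (q / 2)) < ⊤) :
    ∀ ε, 0 < ε → ∃ C, ∀ R, 0 < R → ∫ r in (0:ℝ)..R, r * (∫ z in -π..π,
      ((dSnd W (r, z) - dFst U (r, z)) ^ 2 + dSnd W (r, z) ^ 2)) ≤ ε * R ^ 2 + C := by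
  have hWz := (contDiff_dSnd h.contDiff_radial).continuous
  have hUr := (contDiff_dFst h.contDiff_vertical).continuous
  set e : ℝ × ℝ → ℝ := fun p => ((dSnd W p - dFst U p) ^ 2 + dSnd W p ^ 2) / 3 with he
  have hec : Continuous e := by fun_prop
  have he0 : ∀ p, 0 ≤ e p := fun p => by positivity
  set S : Set (ℝ × ℝ) := Ioi 0 ×ˢ Icc (-π) π with hS
  have hSm : MeasurableSet S := measurableSet_Ioi.prod measurableSet_Icc
  have hgm : Measurable fun p => ENNReal.ofReal (e p ^ (q / 2)) :=
    (hec.measurable.pow_const _).ennreal_ofReal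
  set G : ℝ × ℝ → ENNReal := S.indicator fun p => ENNReal.ofReal (e p ^ (q / 2)) with hG
  have hGm : Measurable G := hgm.indicator hSm
  have hslab : MeasurableSet {x : E3 | x 2 ∈ Icc (-π) π} :=
    measurableSet_Icc.preimage (by fun_prop : Measurable fun x : E3 => x 2)
  have h3 : ∫⁻ x : E3, G (rr x, x 2) < ⊤ := by
    refine lt_of_le_of_lt ?_ hfin
    rw [← lintegral_indicator hslab]
    refine lintegral_mono fun x => ?_
    by_cases hx : (rr x, x 2) ∈ S
    · have hx' : x ∈ {x : E3 | x 2 ∈ Icc (-π) π} := hx.2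
      have hp : 0 < rr x := hx.1
      rw [hG, indicator_of_mem hx, indicator_of_mem hx']
      refine ENNReal.ofReal_le_ofReal (rpow_le_rpow (he0 _) ?_ (by linarith))
      have := h.shear_le_gradSq3 hp
      simp only [he]
      linarith
    · rw [hG, indicator_of_notMem hx]
      exact zero_le
  rw [lintegral_cylindrical hGm] at h3
  have h4 : ∫⁻ r in Ioi (0:ℝ), ∫⁻ z, ENNReal.ofReal r * G (r, z) < ⊤ :=
    ENNReal.lt_top_of_mul_ne_top_left h3.ne (ENNReal.ofReal_pos.2 two_pi_pos).ne'
  have h5 : ∫⁻ r in Ioi (0:ℝ), ∫⁻ z in Icc (-π) π,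
      ENNReal.ofReal r * ENNReal.ofReal (e (r, z) ^ (q / 2)) < ⊤ := by
    refine lt_of_eq_of_lt (setLIntegral_congr_fun measurableSet_Ioi fun r hr => ?_) h4
    rw [← lintegral_indicator measurableSet_Icc]
    refine lintegral_congr fun z => ?_
    by_cases hz : z ∈ Icc (-π) π
    · rw [indicator_of_mem hz, hG, indicator_of_mem (show (r, z) ∈ S from ⟨hr, hz⟩)]
    · rw [indicator_of_notMem hz, hG,
        indicator_of_notMem (show (r, z) ∉ S from fun h => hz h.2), mul_zero]
  intro ε hε
  obtain ⟨C, hC⟩ := averaged_bound_of_lintegral_lt_top hec he0 hq h5 (ε / 3) (by positivity)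
  refine ⟨3 * C, fun R hR => ?_⟩
  have := hC R hR
  simp only [he, intervalIntegral.integral_div, ← mul_div_assoc] at this
  linarith

end HasProfiles

namespace AxisymNoSwirlNSWholeSlab

variable {v : E3 → E3} {p : E3 → ℝ} {vr vz : ℝ → ℝ → ℝ}

theorem apply_meridian_zero (hsol : AxisymNoSwirlNSWholeSlab v p vr vz) {r : ℝ} (hr : 0 < r)
    (z : ℝ) : v (meridian (r, z)) 0 = vr r z := by
  rw [(hsol.axisym_no_swirl _).1, rr_meridian hr.le, meridian_apply_zero, meridian_apply_two,
    div_self hr.ne', mul_one]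

theorem apply_meridian_two (hsol : AxisymNoSwirlNSWholeSlab v p vr vz) {r : ℝ} (hr : 0 ≤ r)
    (z : ℝ) : v (meridian (r, z)) 2 = vz r z := by
  rw [(hsol.axisym_no_swirl _).2.2, rr_meridian hr, meridian_apply_two]

theorem hasProfiles (hsol : AxisymNoSwirlNSWholeSlab v p vr vz) :
    HasProfiles v (fun x => v (meridian x) 0) (fun x => v (meridian x) 2) where
  contDiff_field := hsol.smooth_v
  contDiff_radial := (contDiff_component hsol.smooth_v 0).comp meridian.contDiff
  contDiff_vertical := (contDiff_component hsol.smooth_v 2).comp meridian.contDiff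
  apply_zero x := by
    rcases (show 0 ≤ rr x from Real.sqrt_nonneg _).eq_or_lt with hx | hx
    · rw [(hsol.axisym_no_swirl x).1, ← hx, div_zero, mul_zero, mul_zero]
    · rw [hsol.apply_meridian_zero hx, (hsol.axisym_no_swirl x).1]
  apply_one x := by
    rcases (show 0 ≤ rr x from Real.sqrt_nonneg _).eq_or_lt with hx | hx
    · rw [(hsol.axisym_no_swirl x).2.1, ← hx, div_zero, mul_zero, mul_zero]
    · rw [hsol.apply_meridian_zero hx, (hsol.axisym_no_swirl x).2.1]
  apply_two x := by
    rw [hsol.apply_meridian_two (show 0 ≤ rr x from Real.sqrt_nonneg _), (hsol.axisym_no_swirl x).2.2]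

theorem apply_one_meridian (hsol : AxisymNoSwirlNSWholeSlab v p vr vz) (x : ℝ × ℝ) :
    v (meridian x) 1 = 0 := by
  rw [(hsol.axisym_no_swirl _).2.1, meridian_apply_one, zero_div, mul_zero]

/-- The vertical and radial components of the gradient agree in the half-plane `r > 0`. -/
theorem planar_curl_free (hsol : AxisymNoSwirlNSWholeSlab v p vr vz) {q : ℝ} (hq : 2 ≤ q)
    (hdiri : ∫⁻ x : E3 in {x : E3 | x 2 ∈ Icc (-π) π},
      ENNReal.ofReal ((gradSq3 v x) ^ (q / 2)) < ⊤) (r z : ℝ) (hr : 0 < r) :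
    dSnd (fun x => v (meridian x) 0) (r, z) = dFst (fun x => v (meridian x) 2) (r, z) := by
  have hprof := hsol.hasProfiles
  have h0 := contDiff_component hsol.smooth_v 0
  have h2 := contDiff_component hsol.smooth_v 2
  have hper : ∀ r z, v (meridian (r, z + 2 * π)) = v (meridian (r, z)) := fun r z => by
    rw [meridian_add_period, hsol.periodic]
  refine _root_.planar_curl_free (P := fun x => p (meridian x)) hprof.contDiff_radial
    hprof.contDiff_vertical (hsol.smooth_p.comp meridian.contDiff)
    (fun r z => by simp only [hper]) (fun r z => by simp only [hper]) (fun z => ?_)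
    (fun r z hr => ?_) (fun r z hr => ?_) (fun r z hr => ?_) (hprof.averaged_shear_bound hq hdiri)
    r z hr
  · rw [(hsol.axisym_no_swirl _).1, meridian_apply_zero, zero_div, mul_zero]
  · have h := hsol.incompressible (meridian (r, z))
    have h1 : pd 1 (fun y => v y 1) (meridian (r, z)) = v (meridian (r, z)) 0 / r := by
      have hpos : 0 < rr (meridian (r, z)) := by rwa [rr_meridian hr.le]
      rw [hprof.pd_one hpos]
      simp [rr_meridian hr.le, meridian_apply_zero, meridian_apply_one, meridian_apply_two]
      rfl
    rw [Fin.sum_univ_three, h1] at h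
    rw [dFst_comp_meridian h0, dSnd_comp_meridian h2]
    exact h
  · have h := hsol.momentum (meridian (r, z)) 0
    simp only [Fin.sum_univ_three] at h
    rw [hprof.pd_one_pd_one_zero hr, hsol.apply_one_meridian] at h
    simp only [dFst_comp_meridian h0, dSnd_comp_meridian h0, dFst_comp_meridian (contDiff_pd h0 0),
      dSnd_comp_meridian (contDiff_pd h0 2), dFst_comp_meridian hsol.smooth_p] at h ⊢
    linarith
  · have h := hsol.momentum (meridian (r, z)) 2
    simp only [Fin.sum_univ_three] at h
    rw [hprof.pd_one_pd_one_two hr, hsol.apply_one_meridian] at h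
    simp only [dFst_comp_meridian h2, dSnd_comp_meridian h2, dFst_comp_meridian (contDiff_pd h2 0),
      dSnd_comp_meridian (contDiff_pd h2 2), dSnd_comp_meridian hsol.smooth_p] at h ⊢
    linarith

theorem omTheta_eq (hsol : AxisymNoSwirlNSWholeSlab v p vr vz) {r : ℝ} (hr : 0 < r) (z : ℝ) :
    omTheta vr vz r z =
      dSnd (fun x => v (meridian x) 0) (r, z) - dFst (fun x => v (meridian x) 2) (r, z) := by
  have hprof := hsol.hasProfiles
  rw [omTheta, dzz, dr, ← (hasDerivAt_snd_line hprof.contDiff_radial r z).deriv,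
    ← (hasDerivAt_fst_line hprof.contDiff_vertical r z).deriv]
  congr 1
  · exact congrArg (fun f => deriv f z) (funext fun t => (hsol.apply_meridian_zero hr t).symm)
  · refine Filter.EventuallyEq.deriv_eq ?_
    filter_upwards [Ioi_mem_nhds hr] with s hs
    exact (hsol.apply_meridian_two (le_of_lt hs) z).symm

end AxisymNoSwirlNSWholeSlab

/-- a smooth axisymmetric no-swirl solution in `ℝ² × S¹` with
finite generalized Dirichlet integral has identically vanishing vorticity
(`ω^θ ≡ 0`), i.e. `∇ × v = 0` in `ℝ³`. -/
theorem curl_free_slab (q : ℝ) (hq : 2 ≤ q)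
    (v : E3 → E3) (p : E3 → ℝ) (vr vz : ℝ → ℝ → ℝ)
    (hsol : AxisymNoSwirlNSWholeSlab v p vr vz)
    (hdiri : ∫⁻ x : E3 in {x : E3 | x 2 ∈ Icc (-π) π},
      ENNReal.ofReal ((gradSq3 v x) ^ (q / 2)) < ⊤) :
    (∀ r z : ℝ, 0 < r → omTheta vr vz r z = 0) ∧
    (∀ x : E3, ∀ i j : Fin 3,
      pd i (fun y => v y j) x = pd j (fun y => v y i) x) := by
  have hcurl := hsol.planar_curl_free hq hdiri
  exact ⟨fun r z hr => by rw [hsol.omTheta_eq hr z, hcurl r z hr, sub_self],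
    fun x i j => hsol.hasProfiles.curl_free_of_planar hcurl x i j⟩
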